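/- arXiv:2004.13210 — 2 statements merged into one kernel-verified Lean document; each statement's English description precedes it below -/
import Mathlib

section
/- The left and right q-deformed Haldane–Shastry Hamiltonians commute: H^L ∘ H^R = H^R ∘ H^L as endomorphisms of H = (ℂ²)^{⊗N}. -/
open scoped BigOperators

noncomputable section

namespace Stmt0

/-- The primitive `N`-th root of unity `ω = exp(2πi/N)`. -/
def omega (N : ℕ) : ℂ := Complex.exp (2 * (Real.pi : ℂ) * Complex.I / (N : ℂ))

/-- The coordinates `z_j = ω^j`. -/
def z (N : ℕ) (j : ℕ) : ℂ := omega N ^ j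

/-- The spin-chain Hilbert space `H = (ℂ²)^{⊗N}`, realised as the space of complex functions on
spin configurations.  The sites `1, …, N` are labelled by `ZMod N` (site `j` is `(j : ZMod N)`),
and `false = ↑`, `true = ↓`. -/
abbrev Chain (N : ℕ) := (ZMod N → Bool) → ℂ

/-- The operator acting on the tensor factors at the (distinct) sites `a` and `b` by the
two-site matrix with entries `A out_a out_b in_a in_b`, and by the identity elsewhere. -/
def twoSiteOp {N : ℕ} (A : Bool → Bool → Bool → Bool → ℂ) (a b : ZMod N) :
    Chain N → Chain N := fun ψ x =>
  ∑ s : Bool × Bool,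
    A (x a) (x b) s.1 s.2 * ψ (Function.update (Function.update x a s.1) b s.2)

def fR (q u : ℂ) : ℂ := (u - 1) / (q * u - q⁻¹)

def gR (q u : ℂ) : ℂ := (q - q⁻¹) / (q * u - q⁻¹)

/-- Matrix entries of the R-matrix `Ř(u)` in the ordered basis `(↑↑, ↑↓, ↓↑, ↓↓)`. -/
def RE (q u : ℂ) : Bool → Bool → Bool → Bool → ℂ
  | false, false, false, false => 1
  | false, true, false, true => u * gR q u
  | false, true, true, false => fR q u
  | true, false, false, true => fR q u
  | true, false, true, false => gR q u
  | true, true, true, true => 1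
  | _, _, _, _ => 0

/-- Matrix entries of the Temperley–Lieb generator `e` in the basis `(↑↑, ↑↓, ↓↑, ↓↓)`. -/
def eE (q : ℂ) : Bool → Bool → Bool → Bool → ℂ
  | false, true, false, true => q⁻¹
  | false, true, true, false => -1
  | true, false, false, true => -1
  | true, false, true, false => q
  | _, _, _, _ => 0

/-- `Ř_{k,k+1}(u)` acting on sites `k, k+1`. -/
def Rop (N : ℕ) (q u : ℂ) (k : ℕ) : Chain N → Chain N :=
  twoSiteOp (RE q u) ((k : ℕ) : ZMod N) (((k + 1 : ℕ)) : ZMod N)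

/-- The Temperley–Lieb generator `e_k` acting on sites `k, k+1`. -/
def eop (N : ℕ) (q : ℂ) (k : ℕ) : Chain N → Chain N :=
  twoSiteOp (eE q) ((k : ℕ) : ZMod N) (((k + 1 : ℕ)) : ZMod N)

/-- Composition of a list of operators (the head of the list acts last). -/
def compList {α : Type*} (l : List (α → α)) : α → α := l.foldr (· ∘ ·) id

/-- The long-range spin interaction
`S^L_{[i,j]} = Ř_{j−1,j}(z_j/z_{j−1})⋯Ř_{i+1,i+2}(z_j/z_{i+1}) ∘ e_i ∘
Ř_{i+1,i+2}(z_{i+1}/z_j)⋯Ř_{j−1,j}(z_{j−1}/z_j)` (for `1 ≤ i < j ≤ N`). -/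
def SL (N : ℕ) (q : ℂ) (i j : ℕ) : Chain N → Chain N :=
  compList (((List.range' (i + 1) (j - 1 - i)).reverse).map fun k => Rop N q (z N j / z N k) k) ∘
    eop N q i ∘
      compList ((List.range' (i + 1) (j - 1 - i)).map fun k => Rop N q (z N k / z N j) k)

/-- The long-range spin interaction
`S^R_{[i,j]} = Ř_{i,i+1}(z_{i+1}/z_i)⋯Ř_{j−2,j−1}(z_{j−1}/z_i) ∘ e_{j−1} ∘
Ř_{j−2,j−1}(z_i/z_{j−1})⋯Ř_{i,i+1}(z_i/z_{i+1})` (for `1 ≤ i < j ≤ N`). -/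
def SR (N : ℕ) (q : ℂ) (i j : ℕ) : Chain N → Chain N :=
  compList ((List.range' i (j - 1 - i)).map fun k => Rop N q (z N (k + 1) / z N i) k) ∘
    eop N q (j - 1) ∘
      compList (((List.range' i (j - 1 - i)).reverse).map fun k => Rop N q (z N i / z N (k + 1)) k)

/-- The symmetric q-integer `[n]_q = (qⁿ − q⁻ⁿ)/(q − q⁻¹)`. -/
def qint (q : ℂ) (n : ℕ) : ℂ := (q ^ n - q⁻¹ ^ n) / (q - q⁻¹)

/-- The pair potential `V(x, y) = x·y/((q·x − q⁻¹·y)·(q·y − q⁻¹·x))`. -/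
def pot (q x y : ℂ) : ℂ := x * y / ((q * x - q⁻¹ * y) * (q * y - q⁻¹ * x))

/-- The left q-deformed Haldane–Shastry Hamiltonian
`H^L = ([N]_q/N)·Σ_{1 ≤ i < j ≤ N} V(z_i, z_j)·S^L_{[i,j]}`. -/
def HL (N : ℕ) (q : ℂ) : Chain N → Chain N :=
  (qint q N / (N : ℂ)) • ∑ j ∈ Finset.Icc 1 N, ∑ i ∈ Finset.Ico 1 j,
    pot q (z N i) (z N j) • SL N q i j

/-- The right q-deformed Haldane–Shastry Hamiltonian
`H^R = ([N]_q/N)·Σ_{1 ≤ i < j ≤ N} V(z_i, z_j)·S^R_{[i,j]}`. -/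
def HR (N : ℕ) (q : ℂ) : Chain N → Chain N :=
  (qint q N / (N : ℂ)) • ∑ j ∈ Finset.Icc 1 N, ∑ i ∈ Finset.Ico 1 j,
    pot q (z N i) (z N j) • SR N q i j

/-! ### The Hecke-type relations and the Baxterised generators -/

section Algebra

variable {A : Type*} [Ring A] [Algebra ℂ A]

/-- The Temperley–Lieb relations, with the braid-type relations imposed on the first `n`
generators only (the remaining ones may be zero). -/
structure IsTemperleyLieb (q : ℂ) (n : ℕ) (e : ℕ → A) : Prop where
  sq : ∀ k, e k * e k = (q + q⁻¹) • e k
  up : ∀ k, k + 1 < n → e k * e (k + 1) * e k = e k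
  down : ∀ k, k + 1 < n → e (k + 1) * e k * e (k + 1) = e (k + 1)
  comm : ∀ k l, k + 2 ≤ l → Commute (e k) (e l)

/-- The parameters in `S` are non-zero and avoid all poles of the R-matrix. -/
structure IsRegularSet (q : ℂ) (S : Set ℂ) : Prop where
  finite : S.Finite
  ne_zero : ∀ x ∈ S, x ≠ 0
  no_pole : ∀ x ∈ S, ∀ y ∈ S, q * x - q⁻¹ * y ≠ 0

/-- The R-matrix `Ř_k(u) = 1 - f(u) e_k`. -/
def bax (q : ℂ) (e : ℕ → A) (k : ℕ) (u : ℂ) : A := 1 - fR q u • e k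

/-- The operator carrying a line with parameter `w` from position `a` to the right, through lines
with parameters `ys`. -/
def moveRight (q : ℂ) (e : ℕ → A) : ℕ → ℂ → List ℂ → A
  | _, _, [] => 1
  | a, w, y :: ys => moveRight q e (a + 1) w ys * bax q e a (w / y)

/-- The operator carrying a line with parameter `w` to the left, to position `a`, through lines
with parameters `ys`. -/
def moveLeft (q : ℂ) (e : ℕ → A) : ℕ → ℂ → List ℂ → A
  | _, _, [] => 1
  | a, w, y :: ys => bax q e a (y / w) * moveLeft q e (a + 1) w ys

/-- The interaction of a line `w` with the lines `ys` to its left, which start at position `a`. -/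
def leftSum (q : ℂ) (e : ℕ → A) : ℕ → ℂ → List ℂ → A
  | _, _, [] => 0
  | a, w, y :: ys => pot q y w • (moveRight q e (a + 1) w ys * e a * moveLeft q e (a + 1) w ys) +
      leftSum q e (a + 1) w ys

/-- The interaction of a line `w` at position `a` with the lines `ys` to its right. -/
def rightSum (q : ℂ) (e : ℕ → A) : ℕ → ℂ → List ℂ → A
  | _, _, [] => 0
  | a, w, y :: ys => pot q w y • e a +
      bax q e a (y / w) * rightSum q e (a + 1) w ys * bax q e a (w / y)

/-- The sum of the interactions of the lines `ws` with all lines to their left, where `ws` is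
preceded by the lines `pre`. -/
def totalLeft (q : ℂ) (e : ℕ → A) : List ℂ → List ℂ → A
  | _, [] => 0
  | pre, w :: ws => leftSum q e 0 w pre + totalLeft q e (pre ++ [w]) ws

variable {q : ℂ} {n : ℕ} {e : ℕ → A} {S : Set ℂ}

theorem fR_div {x y : ℂ} (hy : y ≠ 0) : fR q (x / y) = (x - y) / (q * x - q⁻¹ * y) := by
  unfold fR
  rw [show x / y - 1 = (x - y) / y by field_simp,
    show q * (x / y) - q⁻¹ = (q * x - q⁻¹ * y) / y by field_simp]
  rw [div_div_div_cancel_right₀ hy]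

theorem bax_self (k : ℕ) {w : ℂ} (hw : w ≠ 0) : bax q e k (w / w) = 1 := by
  simp [bax, fR_div hw]

theorem IsTemperleyLieb.commute_bax (h : IsTemperleyLieb q n e) {k l : ℕ} (hkl : k + 2 ≤ l)
    (u v : ℂ) : Commute (bax q e k u) (bax q e l v) := by
  unfold bax
  exact ((Commute.one_left _).sub_left
    ((((Commute.one_right _).sub_right ((h.comm k l hkl).smul_right _))).smul_left _))

theorem IsTemperleyLieb.commute_e_bax (h : IsTemperleyLieb q n e) {k l : ℕ} (hkl : k + 2 ≤ l)
    (v : ℂ) : Commute (e k) (bax q e l v) :=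
  (Commute.one_right _).sub_right ((h.comm k l hkl).smul_right _)

theorem commute_moveRight_right {b : A} {a : ℕ} (hb : ∀ k, a ≤ k → ∀ u, Commute b (bax q e k u))
    (w : ℂ) (ys : List ℂ) : Commute b (moveRight q e a w ys) := by
  induction ys generalizing a with
  | nil => exact Commute.one_right _
  | cons y ys ih => exact (ih fun k hk => hb k (by omega)).mul_right (hb a le_rfl _)

theorem commute_moveLeft_right {b : A} {a : ℕ} (hb : ∀ k, a ≤ k → ∀ u, Commute b (bax q e k u))
    (w : ℂ) (ys : List ℂ) : Commute b (moveLeft q e a w ys) := by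
  induction ys generalizing a with
  | nil => exact Commute.one_right _
  | cons y ys ih => exact (hb a le_rfl _).mul_right (ih fun k hk => hb k (by omega))

theorem commute_moveRight_left {b : A} {a : ℕ} (w : ℂ) (ys : List ℂ)
    (hb : ∀ k, k < a + ys.length → ∀ u, Commute b (bax q e k u)) :
    Commute b (moveRight q e a w ys) := by
  induction ys generalizing a with
  | nil => exact Commute.one_right _
  | cons y ys ih =>
    simp only [List.length_cons] at hb
    exact (ih fun k hk => hb k (by omega)).mul_right (hb a (by omega) _)

theorem commute_moveLeft_left {b : A} {a : ℕ} (w : ℂ) (ys : List ℂ)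
    (hb : ∀ k, k < a + ys.length → ∀ u, Commute b (bax q e k u)) :
    Commute b (moveLeft q e a w ys) := by
  induction ys generalizing a with
  | nil => exact Commute.one_right _
  | cons y ys ih =>
    simp only [List.length_cons] at hb
    exact (hb a (by omega) _).mul_right (ih fun k hk => hb k (by omega))

theorem commute_leftSum {b : A} {a : ℕ} (w : ℂ)
    (ys : List ℂ) (hb : ∀ k, k < a + ys.length → Commute b (e k)) :
    Commute b (leftSum q e a w ys) := by
  have hbax : ∀ k, k < a + ys.length → ∀ u, Commute b (bax q e k u) := fun k hk u =>
    (Commute.one_right _).sub_right ((hb k hk).smul_right _)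
  induction ys generalizing a with
  | nil => exact Commute.zero_right _
  | cons y ys ih =>
    simp only [List.length_cons] at hb hbax
    refine Commute.add_right (Commute.smul_right (Commute.mul_right (Commute.mul_right ?_ ?_) ?_) _)
      (ih (fun k hk => hb k (by omega)) (fun k hk => hbax k (by omega)))
    · exact commute_moveRight_left _ _ fun k hk => hbax k (by omega)
    · exact hb _ (by omega)
    · exact commute_moveLeft_left _ _ fun k hk => hbax k (by omega)

theorem moveRight_append (a : ℕ) (w : ℂ) (xs ys : List ℂ) :
    moveRight q e a w (xs ++ ys) =
      moveRight q e (a + xs.length) w ys * moveRight q e a w xs := by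
  induction xs generalizing a with
  | nil => simp [moveRight]
  | cons x xs ih =>
    simp [moveRight, ih, mul_assoc, Nat.add_assoc, Nat.add_comm 1]

theorem moveLeft_append (a : ℕ) (w : ℂ) (xs ys : List ℂ) :
    moveLeft q e a w (xs ++ ys) =
      moveLeft q e a w xs * moveLeft q e (a + xs.length) w ys := by
  induction xs generalizing a with
  | nil => simp [moveLeft]
  | cons x xs ih =>
    simp [moveLeft, ih, mul_assoc, Nat.add_assoc, Nat.add_comm 1]

theorem totalLeft_append (pre xs ys : List ℂ) :
    totalLeft q e pre (xs ++ ys) = totalLeft q e pre xs + totalLeft q e (pre ++ xs) ys := by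
  induction xs generalizing pre with
  | nil => simp [totalLeft]
  | cons x xs ih => simp [totalLeft, ih, add_assoc]

theorem IsTemperleyLieb.bax_mul_bax_inv (h : IsTemperleyLieb q n e) (hq : q ≠ 0)
    (hS : IsRegularSet q S) {x y : ℂ} (hx : x ∈ S) (hy : y ∈ S) (k : ℕ) :
    bax q e k (x / y) * bax q e k (y / x) = 1 := by
  have h1 := hS.no_pole x hx y hy
  have h2 := hS.no_pole y hy x hx
  have key : fR q (x / y) * fR q (y / x) * (q + q⁻¹) = fR q (x / y) + fR q (y / x) := by
    rw [fR_div (hS.ne_zero y hy), fR_div (hS.ne_zero x hx), div_mul_div_comm, div_add_div _ _ h1 h2,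
      div_mul_eq_mul_div]
    congr 1
    field_simp
    ring
  have : bax q e k (x / y) * bax q e k (y / x) = 1 +
      (fR q (x / y) * fR q (y / x) * (q + q⁻¹) - (fR q (x / y) + fR q (y / x))) • e k := by
    simp only [bax, mul_sub, sub_mul, one_mul, mul_one, smul_mul_smul_comm, h.sq]
    module
  rw [this, key, sub_self, zero_smul, add_zero]

theorem IsTemperleyLieb.moveRight_mul_moveLeft (h : IsTemperleyLieb q n e) (hq : q ≠ 0)
    (hS : IsRegularSet q S) {w : ℂ} (hw : w ∈ S) {ys : List ℂ} (hys : ∀ y ∈ ys, y ∈ S) (a : ℕ) :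
    moveRight q e a w ys * moveLeft q e a w ys = 1 := by
  induction ys generalizing a with
  | nil => simp [moveRight, moveLeft]
  | cons y ys ih =>
    simp only [List.mem_cons, forall_eq_or_imp] at hys
    simp only [moveRight, moveLeft]
    rw [mul_assoc, ← mul_assoc (bax q e a _), h.bax_mul_bax_inv hq hS hw hys.1, one_mul,
      ih hys.2]

theorem IsTemperleyLieb.moveLeft_mul_moveRight (h : IsTemperleyLieb q n e) (hq : q ≠ 0)
    (hS : IsRegularSet q S) {w : ℂ} (hw : w ∈ S) {ys : List ℂ} (hys : ∀ y ∈ ys, y ∈ S) (a : ℕ) :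
    moveLeft q e a w ys * moveRight q e a w ys = 1 := by
  induction ys generalizing a with
  | nil => simp [moveRight, moveLeft]
  | cons y ys ih =>
    simp only [List.mem_cons, forall_eq_or_imp] at hys
    simp only [moveRight, moveLeft]
    rw [mul_assoc, ← mul_assoc (moveLeft q e _ _ _), ih hys.2, one_mul,
      h.bax_mul_bax_inv hq hS hys.1 hw]

/-- The Yang–Baxter equation. -/
theorem IsTemperleyLieb.yang_baxter (h : IsTemperleyLieb q n e) (hq : q ≠ 0)
    (hS : IsRegularSet q S) {x y w : ℂ} (hx : x ∈ S) (hy : y ∈ S) (hw : w ∈ S) {k : ℕ}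
    (hk : k + 1 < n) :
    bax q e k (y / x) * bax q e (k + 1) (w / x) * bax q e k (w / y) =
      bax q e (k + 1) (w / y) * bax q e k (w / x) * bax q e (k + 1) (y / x) := by
  have h1 := hS.no_pole y hy x hx
  have h2 := hS.no_pole w hw x hx
  have h3 := hS.no_pole w hw y hy
  set a := fR q (y / x) with ha
  set b := fR q (w / x) with hb
  set c := fR q (w / y) with hc
  have key : a + c + a * b * c - a * c * (q + q⁻¹) = b := by
    rw [ha, hb, hc, fR_div (hS.ne_zero x hx), fR_div (hS.ne_zero x hx), fR_div (hS.ne_zero y hy)]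
    have hd1 : q * (q * y - q⁻¹ * x) = q ^ 2 * y - x := by field_simp
    have hd2 : q * (q * w - q⁻¹ * x) = q ^ 2 * w - x := by field_simp
    have hd3 : q * (q * w - q⁻¹ * y) = q ^ 2 * w - y := by field_simp
    generalize q * y - q⁻¹ * x = d₁ at *
    generalize q * w - q⁻¹ * x = d₂ at *
    generalize q * w - q⁻¹ * y = d₃ at *
    have hd1' : d₁ = (q ^ 2 * y - x) / q := by rw [← hd1]; field_simp
    have hd2' : d₂ = (q ^ 2 * w - x) / q := by rw [← hd2]; field_simp
    have hd3' : d₃ = (q ^ 2 * w - y) / q := by rw [← hd3]; field_simp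
    rw [← sub_eq_zero]
    field_simp
    rw [hd1', hd2', hd3']
    field_simp
    ring
  have e121 := h.up k hk
  have e212 := h.down k hk
  have l : bax q e k (y / x) * bax q e (k + 1) (w / x) * bax q e k (w / y) =
      1 - (a + c + a * b * c - a * c * (q + q⁻¹)) • e k - b • e (k + 1) +
        (a * b) • (e k * e (k + 1)) + (b * c) • (e (k + 1) * e k) := by
    simp only [bax, ← ha, ← hb, ← hc, mul_sub, sub_mul, one_mul, mul_one, smul_mul_smul_comm, h.sq,
      e121]
    module
  have r : bax q e (k + 1) (w / y) * bax q e k (w / x) * bax q e (k + 1) (y / x) =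
      1 - (a + c + a * b * c - a * c * (q + q⁻¹)) • e (k + 1) - b • e k +
        (a * b) • (e k * e (k + 1)) + (b * c) • (e (k + 1) * e k) := by
    simp only [bax, ← ha, ← hb, ← hc, mul_sub, sub_mul, one_mul, mul_one, smul_mul_smul_comm, h.sq,
      e212]
    module
  rw [l, r, key]
  module

/-- Two lines exchanging their order to the left or to the right of a bundle of lines. -/
theorem IsTemperleyLieb.yang_baxter_list (h : IsTemperleyLieb q n e) (hq : q ≠ 0)
    (hS : IsRegularSet q S) {v w : ℂ} (hv : v ∈ S) (hw : w ∈ S) {ys : List ℂ}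
    (hys : ∀ y ∈ ys, y ∈ S) {a : ℕ} (ha : a + ys.length < n) :
    moveLeft q e a v ys * bax q e (a + ys.length) (w / v) * moveRight q e a w ys =
      moveRight q e (a + 1) w ys * bax q e a (w / v) * moveLeft q e (a + 1) v ys := by
  induction ys generalizing a with
  | nil => simp [moveRight, moveLeft]
  | cons y ys ih =>
    simp only [List.mem_cons, forall_eq_or_imp] at hys
    simp only [List.length_cons] at ha ⊢
    have ih' := ih hys.2 (a := a + 1) (by omega)
    have c1 : Commute (bax q e a (y / v)) (moveRight q e (a + 2) w ys) :=
      commute_moveRight_right (fun k hk u => h.commute_bax hk _ _) _ _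
    have c2 : Commute (bax q e a (w / y)) (moveLeft q e (a + 2) v ys) :=
      commute_moveLeft_right (fun k hk u => h.commute_bax hk _ _) _ _
    have yb := h.yang_baxter hq hS hv hys.1 hw (k := a) (by omega)
    simp only [moveRight, moveLeft]
    rw [show a + (ys.length + 1) = a + 1 + ys.length by omega]
    calc _ = bax q e a (y / v) * (moveLeft q e (a + 1) v ys *
          bax q e (a + 1 + ys.length) (w / v) * moveRight q e (a + 1) w ys) *
          bax q e a (w / y) := by simp only [mul_assoc]
      _ = bax q e a (y / v) * moveRight q e (a + 2) w ys * bax q e (a + 1) (w / v) *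
          (moveLeft q e (a + 2) v ys * bax q e a (w / y)) := by rw [ih']; simp only [mul_assoc]
      _ = moveRight q e (a + 2) w ys * (bax q e a (y / v) * bax q e (a + 1) (w / v) *
          bax q e a (w / y)) * moveLeft q e (a + 2) v ys := by
        rw [c1.eq, ← c2.eq]; simp only [mul_assoc]
      _ = _ := by rw [yb]; simp only [mul_assoc]

/-- Moving a line to the right is covariant under exchanging two neighbours it passes. -/
theorem IsTemperleyLieb.moveRight_swap (h : IsTemperleyLieb q n e) (hq : q ≠ 0)
    (hS : IsRegularSet q S) {w x y : ℂ} (hw : w ∈ S) (hx : x ∈ S) (hy : y ∈ S) (pre post : List ℂ)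
    {a : ℕ} (ha : a + pre.length + 1 < n) :
    moveRight q e a w (pre ++ x :: y :: post) * bax q e (a + pre.length + 1) (y / x) =
      bax q e (a + pre.length) (y / x) * moveRight q e a w (pre ++ y :: x :: post) := by
  set k := a + pre.length with hk
  have c1 : Commute (moveRight q e a w pre) (bax q e (k + 1) (y / x)) :=
    (commute_moveRight_left _ _ fun j hj u =>
      (h.commute_bax (by omega : j + 2 ≤ k + 1) _ _).symm).symm
  have c2 : Commute (bax q e k (y / x)) (moveRight q e (k + 2) w post) :=
    commute_moveRight_right (fun k hk u => h.commute_bax hk _ _) _ _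
  have yb := h.yang_baxter hq hS hx hy hw (k := k) ha
  rw [moveRight_append, moveRight_append, ← hk]
  simp only [moveRight]
  calc _ = moveRight q e (k + 2) w post * bax q e (k + 1) (w / y) * bax q e k (w / x) *
        (moveRight q e a w pre * bax q e (k + 1) (y / x)) := by simp only [mul_assoc]
    _ = moveRight q e (k + 2) w post * (bax q e (k + 1) (w / y) * bax q e k (w / x) *
        bax q e (k + 1) (y / x)) * moveRight q e a w pre := by
      rw [c1.eq]; simp only [mul_assoc]
    _ = (moveRight q e (k + 2) w post * bax q e k (y / x)) * bax q e (k + 1) (w / x) *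
        bax q e k (w / y) * moveRight q e a w pre := by
      rw [← yb]; simp only [mul_assoc]
    _ = _ := by rw [← c2.eq]; simp only [mul_assoc]

/-! ### The exchange identity -/

/-- The lines `g 0, …, g (j - 1)`. -/
def linesBefore (g : ℕ → ℂ) (j : ℕ) : List ℂ := (List.range' 0 j).map g

/-- The lines `g (j + 1), …, g (N - 1)`. -/
def linesAfter (g : ℕ → ℂ) (N j : ℕ) : List ℂ := (List.range' (j + 1) (N - 1 - j)).map g

/-- The `j`-th line moves to the far left, changes its parameter to `w`, moves to the far right,
changes its parameter back and returns. -/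
def leftLoop (q : ℂ) (e : ℕ → A) (g : ℕ → ℂ) (N j : ℕ) (w : ℂ) : A :=
  moveLeft q e j (g j) (linesAfter g N j) *
    moveRight q e 0 w (linesBefore g j ++ linesAfter g N j) *
      moveLeft q e 0 (g j) (linesBefore g j)

/-- The `j`-th line moves to the far right, changes its parameter to `w`, moves to the far left,
changes its parameter back and returns. -/
def rightLoop (q : ℂ) (e : ℕ → A) (g : ℕ → ℂ) (N j : ℕ) (w : ℂ) : A :=
  moveRight q e 0 (g j) (linesBefore g j) *
    moveLeft q e 0 w (linesBefore g j ++ linesAfter g N j) *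
      moveRight q e j (g j) (linesAfter g N j)

theorem length_linesBefore (g : ℕ → ℂ) (j : ℕ) : (linesBefore g j).length = j := by
  simp [linesBefore]

theorem length_linesAfter (g : ℕ → ℂ) (N j : ℕ) : (linesAfter g N j).length = N - 1 - j := by
  simp [linesAfter]

theorem range'_split {b n i : ℕ} (h1 : b ≤ i) (h2 : i < b + n) :
    List.range' b n = List.range' b (i - b) ++ i :: List.range' (i + 1) (b + n - 1 - i) := by
  have e1 : n = (i - b) + ((b + n - 1 - i) + 1) := by omega
  have e2 : b + (i - b) = i := by omega
  conv_lhs => rw [e1, ← List.range'_append_1, e2, List.range'_succ]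

theorem linesAfter_split (g : ℕ → ℂ) {N j i : ℕ} (hji : j < i) (hi : i < N) :
    linesAfter g N j = (List.range' (j + 1) (i - (j + 1))).map g ++ g i :: linesAfter g N i := by
  unfold linesAfter
  rw [range'_split (b := j + 1) (i := i) (by omega) (by omega), List.map_append, List.map_cons,
    show j + 1 + (N - 1 - j) - 1 - i = N - 1 - i by omega]

theorem linesBefore_split (g : ℕ → ℂ) {j i : ℕ} (hji : j < i) :
    linesBefore g i = linesBefore g j ++ g j :: (List.range' (j + 1) (i - (j + 1))).map g := by
  unfold linesBefore
  rw [range'_split (b := 0) (i := j) (by omega) (by omega), List.map_append, List.map_cons,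
    show 0 + i - 1 - j = i - (j + 1) by omega, Nat.sub_zero]

theorem mem_linesBefore {g : ℕ → ℂ} (hg : ∀ i, g i ∈ S) (j : ℕ) : ∀ y ∈ linesBefore g j, y ∈ S := by
  simp only [linesBefore, List.mem_map]
  rintro _ ⟨i, -, rfl⟩
  exact hg i

theorem mem_linesAfter {g : ℕ → ℂ} (hg : ∀ i, g i ∈ S) (N j : ℕ) :
    ∀ y ∈ linesAfter g N j, y ∈ S := by
  simp only [linesAfter, List.mem_map]
  rintro _ ⟨i, -, rfl⟩
  exact hg i

theorem mem_linesBefore_append {g : ℕ → ℂ} (hg : ∀ i, g i ∈ S) (N j : ℕ) :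
    ∀ y ∈ linesBefore g j ++ linesAfter g N j, y ∈ S := by
  intro y hy
  rcases List.mem_append.1 hy with hy | hy
  · exact mem_linesBefore hg _ _ hy
  · exact mem_linesAfter hg _ _ _ hy

theorem IsTemperleyLieb.commute_moves (h : IsTemperleyLieb q n e) {v w : ℂ} {k : ℕ}
    (xs : List ℂ) (hk : xs.length + 1 ≤ k) (u : ℂ) :
    Commute (moveRight q e 0 w xs * moveLeft q e 0 v xs) (bax q e k u) :=
  Commute.mul_left
    (commute_moveRight_left _ _ fun j hj u' => (h.commute_bax (by omega : j + 2 ≤ k) _ _).symm).symm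
    (commute_moveLeft_left _ _ fun j hj u' => (h.commute_bax (by omega : j + 2 ≤ k) _ _).symm).symm

theorem IsTemperleyLieb.loop_exchange_right (h : IsTemperleyLieb q n e) (hq : q ≠ 0)
    (hS : IsRegularSet q S) {v w : ℂ} (hv : v ∈ S) (hw : w ∈ S) (xs : List ℂ) {ys : List ℂ}
    (hys : ∀ y ∈ ys, y ∈ S) (zs : List ℂ) (hn : xs.length + ys.length < n) :
    moveLeft q e xs.length v (ys ++ w :: zs) * moveRight q e 0 w (xs ++ (ys ++ w :: zs)) *
        moveLeft q e 0 v xs =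
      moveRight q e 0 w (xs ++ v :: ys) * moveLeft q e 0 v (xs ++ v :: ys ++ zs) *
        moveRight q e (xs ++ v :: ys).length w zs := by
  set a := xs.length with ha
  set X := moveRight q e 0 w xs * moveLeft q e 0 v xs with hX
  set Z := moveLeft q e (a + 1 + ys.length) v zs * moveRight q e (a + 1 + ys.length) w zs with hZ
  have hXb : ∀ k, a + 1 ≤ k → ∀ u, Commute X (bax q e k u) := fun k hk u =>
    h.commute_moves xs hk u
  have c1 : Commute X (moveLeft q e (a + 1) v ys) := commute_moveLeft_right hXb _ _
  have c2 : Commute X Z := (commute_moveLeft_right (fun k hk => hXb k (by omega)) _ _).mul_right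
    (commute_moveRight_right (fun k hk => hXb k (by omega)) _ _)
  have c3 : Commute (moveRight q e a w ys) Z :=
    (commute_moveRight_left _ _ fun j hj u => Commute.mul_left
      (commute_moveLeft_right (fun k hk u' => h.commute_bax (by omega : j + 2 ≤ k) u u') v zs).symm
      (commute_moveRight_right (fun k hk u' => h.commute_bax (by omega : j + 2 ≤ k) u u')
        w zs).symm).symm
  have yb := h.yang_baxter_list hq hS hv hw hys hn
  rw [List.append_assoc, moveLeft_append, moveRight_append, moveRight_append, moveRight_append,
    moveLeft_append, List.cons_append, moveLeft, moveRight, moveRight, moveLeft, moveLeft_append,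
    bax_self _ (hS.ne_zero w hw), bax_self _ (hS.ne_zero v hv)]
  simp only [List.length_append, List.length_cons, ← ha, Nat.zero_add, mul_one, one_mul]
  rw [show a + ys.length + 1 = a + 1 + ys.length by omega,
    show a + (ys.length + 1) = a + 1 + ys.length by omega]
  calc _ = moveLeft q e a v ys * bax q e (a + ys.length) (w / v) *
        (Z * moveRight q e a w ys) * X := by simp only [hX, hZ, mul_assoc]
    _ = (moveLeft q e a v ys * bax q e (a + ys.length) (w / v) * moveRight q e a w ys) *
        (Z * X) := by rw [← c3.eq]; simp only [mul_assoc]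
    _ = moveRight q e (a + 1) w ys * bax q e a (w / v) * (moveLeft q e (a + 1) v ys * X) * Z := by
      rw [yb, ← c2.eq]; simp only [mul_assoc]
    _ = _ := by rw [← c1.eq]; simp only [hX, hZ, mul_assoc]

theorem IsTemperleyLieb.loop_exchange_left (h : IsTemperleyLieb q n e) (hq : q ≠ 0)
    (hS : IsRegularSet q S) {v w : ℂ} (hv : v ∈ S) (hw : w ∈ S) (xs : List ℂ) {ys : List ℂ}
    (hys : ∀ y ∈ ys, y ∈ S) (zs : List ℂ) (hn : xs.length + ys.length < n) :
    moveLeft q e (xs ++ w :: ys).length v zs * moveRight q e 0 w (xs ++ w :: ys ++ zs) *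
        moveLeft q e 0 v (xs ++ w :: ys) =
      moveRight q e 0 w xs * moveLeft q e 0 v (xs ++ (ys ++ v :: zs)) *
        moveRight q e xs.length w (ys ++ v :: zs) := by
  set a := xs.length with ha
  set X := moveRight q e 0 w xs * moveLeft q e 0 v xs with hX
  set Z := moveLeft q e (a + 1 + ys.length) v zs * moveRight q e (a + 1 + ys.length) w zs with hZ
  have hXb : ∀ k, a + 1 ≤ k → ∀ u, Commute X (bax q e k u) := fun k hk u =>
    h.commute_moves xs hk u
  have c1 : Commute X (moveRight q e (a + 1) w ys) := commute_moveRight_right hXb _ _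
  have c2 : Commute X Z := (commute_moveLeft_right (fun k hk => hXb k (by omega)) _ _).mul_right
    (commute_moveRight_right (fun k hk => hXb k (by omega)) _ _)
  have c3 : Commute (moveLeft q e a v ys) Z :=
    (commute_moveLeft_left _ _ fun j hj u => Commute.mul_left
      (commute_moveLeft_right (fun k hk u' => h.commute_bax (by omega : j + 2 ≤ k) u u') v zs).symm
      (commute_moveRight_right (fun k hk u' => h.commute_bax (by omega : j + 2 ≤ k) u u')
        w zs).symm).symm
  have yb := h.yang_baxter_list hq hS hv hw hys hn
  rw [List.append_assoc, moveRight_append, List.cons_append, moveRight, moveRight_append,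
    moveLeft_append, moveLeft_append, moveLeft, moveLeft_append, moveLeft, moveRight_append,
    moveRight, bax_self _ (hS.ne_zero w hw), bax_self _ (hS.ne_zero v hv)]
  simp only [List.length_append, List.length_cons, ← ha, Nat.zero_add, mul_one, one_mul]
  rw [show a + ys.length + 1 = a + 1 + ys.length by omega,
    show a + (ys.length + 1) = a + 1 + ys.length by omega]
  calc _ = Z * (moveRight q e (a + 1) w ys * X) * bax q e a (w / v) *
        moveLeft q e (a + 1) v ys := by simp only [hX, hZ, mul_assoc]
    _ = (X * Z) * (moveRight q e (a + 1) w ys * bax q e a (w / v) *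
        moveLeft q e (a + 1) v ys) := by rw [← c1.eq, c2.eq]; simp only [mul_assoc]
    _ = X * (Z * moveLeft q e a v ys) * bax q e (a + ys.length) (w / v) *
        moveRight q e a w ys := by rw [← yb]; simp only [mul_assoc]
    _ = _ := by rw [← c3.eq]; simp only [hX, hZ, mul_assoc]

/-- Changing the parameter of the `j`-th line to that of the `i`-th line on the left loop amounts
to changing the parameter of the `i`-th line to that of the `j`-th line on the right loop. -/
theorem IsTemperleyLieb.leftLoop_eq_rightLoop (h : IsTemperleyLieb q n e) (hq : q ≠ 0)
    (hS : IsRegularSet q S) {g : ℕ → ℂ} (hg : ∀ i, g i ∈ S) {N i j : ℕ} (hN : N ≤ n + 1)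
    (hi : i < N) (hj : j < N) :
    leftLoop q e g N j (g i) = rightLoop q e g N i (g j) := by
  have hmid : ∀ a b, ∀ y ∈ (List.range' a b).map g, y ∈ S := by
    simp only [List.mem_map]
    rintro a b _ ⟨i, -, rfl⟩
    exact hg i
  unfold leftLoop rightLoop
  rcases lt_trichotomy i j with hij | rfl | hij
  · have := h.loop_exchange_left hq hS (hg j) (hg i) (linesBefore g i)
      (ys := (List.range' (i + 1) (j - (i + 1))).map g) (hmid _ _) (linesAfter g N j)
      (by rw [length_linesBefore, List.length_map, List.length_range']; omega)
    rwa [← linesAfter_split g hij hj, ← linesBefore_split g hij, length_linesBefore,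
      length_linesBefore] at this
  · have hb := mem_linesBefore hg i
    have ha := mem_linesAfter hg N i
    rw [moveRight_append, moveLeft_append, length_linesBefore, Nat.zero_add, ← mul_assoc,
      ← mul_assoc, h.moveLeft_mul_moveRight hq hS (hg i) ha,
      h.moveRight_mul_moveLeft hq hS (hg i) hb, one_mul, one_mul,
      h.moveLeft_mul_moveRight hq hS (hg i) ha, h.moveRight_mul_moveLeft hq hS (hg i) hb]
  · have := h.loop_exchange_right hq hS (hg j) (hg i) (linesBefore g j)
      (ys := (List.range' (j + 1) (i - (j + 1))).map g) (hmid _ _) (linesAfter g N i)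
      (by rw [length_linesBefore, List.length_map, List.length_range']; omega)
    rwa [← linesAfter_split g hij hi, ← linesBefore_split g hij, length_linesBefore,
      length_linesBefore] at this

/-! ### Interpolation at the roots of unity -/

/-- All coordinates of `φ` are polynomials of degree at most `d`. -/
def IsPolynomialMap (d : ℕ) (φ : ℂ → A) : Prop :=
  ∀ f : A →ₗ[ℂ] ℂ, ∃ P : Polynomial ℂ, P.natDegree ≤ d ∧ ∀ p, f (φ p) = P.eval p

theorem isPolynomialMap_const (b : A) : IsPolynomialMap 0 fun _ => b := fun f =>
  ⟨Polynomial.C (f b), by simp, by simp⟩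

theorem IsPolynomialMap.sub {d : ℕ} {φ ψ : ℂ → A} (hφ : IsPolynomialMap d φ)
    (hψ : IsPolynomialMap d ψ) : IsPolynomialMap d fun p => φ p - ψ p := fun f => by
  obtain ⟨P, hP, hPe⟩ := hφ f
  obtain ⟨Q, hQ, hQe⟩ := hψ f
  exact ⟨P - Q, (Polynomial.natDegree_sub_le_of_le hP hQ).trans (max_self d).le, by simp [hPe, hQe]⟩

theorem IsPolynomialMap.sum {ι : Type*} {d : ℕ} {φ : ι → ℂ → A} (s : Finset ι)
    (hφ : ∀ i ∈ s, IsPolynomialMap d (φ i)) : IsPolynomialMap d fun p => ∑ i ∈ s, φ i p :=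
    fun f => by
  have : ∀ i : s, ∃ P : Polynomial ℂ, P.natDegree ≤ d ∧ ∀ p, f (φ i p) = P.eval p :=
    fun i => hφ i i.2 f
  choose P hP hPe using this
  refine ⟨∑ i, P i, Polynomial.natDegree_sum_le_of_forall_le _ _ fun i _ => hP i, fun p => ?_⟩
  rw [map_sum, Polynomial.eval_finsetSum, ← Finset.sum_coe_sort]
  exact Finset.sum_congr rfl fun i _ => hPe i p

theorem IsPolynomialMap.const_mul_mul {d : ℕ} {φ : ℂ → A} (hφ : IsPolynomialMap d φ) (b c : A) :
    IsPolynomialMap d fun p => b * φ p * c := fun f => by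
  obtain ⟨P, hP, hPe⟩ := hφ (f ∘ₗ LinearMap.mulRight ℂ c ∘ₗ LinearMap.mulLeft ℂ b)
  exact ⟨P, hP, fun p => by simp [← hPe]⟩

theorem IsPolynomialMap.mul_linear {d : ℕ} {φ : ℂ → A} (hφ : IsPolynomialMap d φ) (b c : A) :
    IsPolynomialMap (d + 1) fun p => φ p * (p • b + c) := fun f => by
  obtain ⟨P, hP, hPe⟩ := hφ (f ∘ₗ LinearMap.mulRight ℂ b)
  obtain ⟨Q, hQ, hQe⟩ := hφ (f ∘ₗ LinearMap.mulRight ℂ c)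
  refine ⟨Polynomial.X * P + Q, ?_, fun p => ?_⟩
  · refine Polynomial.natDegree_add_le_of_degree_le ?_ (hQ.trans (by omega))
    exact Polynomial.natDegree_mul_le_of_le Polynomial.natDegree_X_le hP |>.trans (by omega)
  · simp [mul_add, ← hPe, ← hQe]

theorem IsPolynomialMap.linear_mul {d : ℕ} {φ : ℂ → A} (hφ : IsPolynomialMap d φ) (b c : A) :
    IsPolynomialMap (d + 1) fun p => (p • b + c) * φ p := fun f => by
  obtain ⟨P, hP, hPe⟩ := hφ (f ∘ₗ LinearMap.mulLeft ℂ b)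
  obtain ⟨Q, hQ, hQe⟩ := hφ (f ∘ₗ LinearMap.mulLeft ℂ c)
  refine ⟨Polynomial.X * P + Q, ?_, fun p => ?_⟩
  · refine Polynomial.natDegree_add_le_of_degree_le ?_ (hQ.trans (by omega))
    exact Polynomial.natDegree_mul_le_of_le Polynomial.natDegree_X_le hP |>.trans (by omega)
  · simp [add_mul, ← hPe, ← hQe]

/-- A polynomial map of degree less than the number of its zeros vanishes. -/
theorem IsPolynomialMap.eq_zero {d : ℕ} {φ : ℂ → A} (hφ : IsPolynomialMap d φ) (s : Finset ℂ)
    (hs : d < s.card) (h0 : ∀ p ∈ s, φ p = 0) (p : ℂ) : φ p = 0 := by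
  refine (Module.forall_dual_apply_eq_zero_iff ℂ (φ p)).1 fun f => ?_
  obtain ⟨P, hP, hPe⟩ := hφ f
  have : P = 0 := Polynomial.eq_zero_of_natDegree_lt_card_of_eval_eq_zero' P s
    (fun x hx => by rw [← hPe, h0 x hx, map_zero]) (hP.trans_lt hs)
  rw [hPe, this, Polynomial.eval_zero]

theorem smul_bax {p c : ℂ} (hc : c ≠ 0) (hp : q * p - q⁻¹ * c ≠ 0) (k : ℕ) :
    (q * p - q⁻¹ * c) • bax q e k (p / c) = p • (q • (1 : A) - e k) + (c • e k - (q⁻¹ * c) • 1) := by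
  rw [bax, fR_div hc, smul_sub, smul_smul, mul_div_cancel₀ _ hp]
  module

theorem exists_moveRight_polynomial {v : ℂ} (hv : v ≠ 0) {ys : List ℂ} (hys : ∀ y ∈ ys, y ≠ 0)
    (a : ℕ) : ∃ φ : ℂ → A, IsPolynomialMap ys.length φ ∧
      ∀ p, (∀ y ∈ ys, q * p - q⁻¹ * (y / v) ≠ 0) →
        (ys.map fun y => q * p - q⁻¹ * (y / v)).prod • moveRight q e a (p * v) ys = φ p := by
  induction ys generalizing a with
  | nil => exact ⟨_, isPolynomialMap_const 1, by simp [moveRight]⟩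
  | cons y ys ih =>
    simp only [List.mem_cons, forall_eq_or_imp] at hys ⊢
    obtain ⟨φ, hφ, hφe⟩ := ih hys.2 (a + 1)
    refine ⟨_, hφ.mul_linear (q • (1 : A) - e a) ((y / v) • e a - (q⁻¹ * (y / v)) • 1),
      fun p hp => ?_⟩
    rw [← smul_bax (div_ne_zero hys.1 hv) hp.1, ← hφe p hp.2, List.map_cons, List.prod_cons,
      moveRight, smul_mul_smul_comm, mul_comm (q * p - _), div_div_eq_mul_div]

theorem exists_moveLeft_polynomial {v : ℂ} (hv : v ≠ 0) {ys : List ℂ} (hys : ∀ y ∈ ys, y ≠ 0)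
    (a : ℕ) : ∃ φ : ℂ → A, IsPolynomialMap ys.length φ ∧
      ∀ p, (∀ y ∈ ys, q * p - q⁻¹ * (v / y) ≠ 0) →
        (ys.map fun y => q * p - q⁻¹ * (v / y)).prod • moveLeft q e a (v / p) ys = φ p := by
  induction ys generalizing a with
  | nil => exact ⟨_, isPolynomialMap_const 1, by simp [moveLeft]⟩
  | cons y ys ih =>
    simp only [List.mem_cons, forall_eq_or_imp] at hys ⊢
    obtain ⟨φ, hφ, hφe⟩ := ih hys.2 (a + 1)
    refine ⟨_, hφ.linear_mul (q • (1 : A) - e a) ((v / y) • e a - (q⁻¹ * (v / y)) • 1),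
      fun p hp => ?_⟩
    rw [← smul_bax (div_ne_zero hv hys.1) hp.1, ← hφe p hp.2, List.map_cons, List.prod_cons,
      moveLeft, smul_mul_smul_comm, div_div_eq_mul_div, div_div_eq_mul_div, mul_comm p y]

theorem prod_sub_mul_of_injOn {N : ℕ} (hN : 0 < N) {ζ : ℂ} (hζ : IsPrimitiveRoot ζ N) {r : ℕ → ℂ}
    (hr : ∀ i, r i ^ N = 1) (hinj : Set.InjOn r (Finset.range N)) (x y : ℂ) :
    ((List.range' 0 N).map fun i => x - y * r i).prod = x ^ N - y ^ N := by
  have himg : (Finset.range N).image r = Polynomial.nthRootsFinset N (1 : ℂ) := by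
    refine Finset.eq_of_subset_of_card_le ?_ ?_
    · intro t ht
      obtain ⟨i, -, rfl⟩ := Finset.mem_image.1 ht
      exact (Polynomial.mem_nthRootsFinset hN _).2 (hr i)
    · rw [hζ.card_nthRootsFinset, Finset.card_image_of_injOn hinj, Finset.card_range]
  rw [hζ.pow_sub_pow_eq_prod_sub_mul x y hN, ← himg, Finset.prod_image hinj,
    ← List.range_eq_range', ← List.prod_toFinset _ List.nodup_range, List.toFinset_range]
  simp only [mul_comm]

theorem linesBefore_append_linesAfter_prod {N j : ℕ} (hj : j < N) (g : ℕ → ℂ) (F : ℂ → ℂ) :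
    F (g j) * ((linesBefore g j ++ linesAfter g N j).map F).prod =
      ((List.range' 0 N).map fun i => F (g i)).prod := by
  rw [range'_split (b := 0) (i := j) (n := N) (by omega) (by omega)]
  simp only [linesBefore, linesAfter, List.map_append, List.map_map, List.prod_append, List.map_cons,
    List.prod_cons, Nat.sub_zero, Nat.zero_add]
  rw [mul_left_comm]
  rfl

section RootsOfUnity

variable {N : ℕ} {ζ : ℂ} {g : ℕ → ℂ}

theorem prod_linesBefore_linesAfter (hζ : IsPrimitiveRoot ζ N)
    (hg : ∀ i, g i = ζ ^ (i + 1)) {j : ℕ} (hj : j < N) (p : ℂ) :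
    (q * p - q⁻¹) * ((linesBefore g j ++ linesAfter g N j).map
      fun y => q * p - q⁻¹ * (y / g j)).prod = (q * p) ^ N - q⁻¹ ^ N := by
  have hN : 0 < N := by omega
  have h0 : ζ ≠ 0 := hζ.ne_zero hN.ne'
  have hg0 : g j ≠ 0 := by rw [hg]; exact pow_ne_zero _ h0
  have := linesBefore_append_linesAfter_prod hj g fun y => q * p - q⁻¹ * (y / g j)
  rw [div_self hg0, mul_one] at this
  rw [this]
  refine prod_sub_mul_of_injOn hN hζ (fun i => ?_) (fun a ha b hb hab => ?_) _ _
  · rw [div_pow, hg, hg, ← pow_mul, ← pow_mul, mul_comm _ N, mul_comm _ N, pow_mul, pow_mul,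
      hζ.pow_eq_one, one_pow, one_pow, div_one]
  · simp only [Finset.coe_range, Set.mem_Iio] at ha hb
    have hab' := (div_left_inj' hg0).1 hab
    rw [hg, hg, pow_succ, pow_succ] at hab'
    exact hζ.pow_inj ha hb (mul_right_cancel₀ h0 hab')

theorem prod_linesBefore_linesAfter_inv (hζ : IsPrimitiveRoot ζ N)
    (hg : ∀ i, g i = ζ ^ (i + 1)) {j : ℕ} (hj : j < N) (p : ℂ) :
    (q * p - q⁻¹) * ((linesBefore g j ++ linesAfter g N j).map
      fun y => q * p - q⁻¹ * (g j / y)).prod = (q * p) ^ N - q⁻¹ ^ N := by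
  have := prod_linesBefore_linesAfter (q := q) (g := fun i => (g i)⁻¹) hζ.inv
    (fun i => by rw [hg, inv_pow]) hj p
  rw [← this]
  simp only [linesBefore, linesAfter, List.map_append, List.map_map]
  simp [Function.comp_def, div_eq_mul_inv, mul_comm]

theorem sum_leftLoop_eq_sum_rightLoop_of_pow (h : IsTemperleyLieb q n e) (hq : q ≠ 0)
    (hS : IsRegularSet q S) (hNn : N ≤ n + 1) (hζ : IsPrimitiveRoot ζ N)
    (hg : ∀ i, g i = ζ ^ (i + 1)) (hgS : ∀ i, g i ∈ S) (k : ℕ) :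
    ∑ j ∈ Finset.range N, leftLoop q e g N j (ζ ^ k * g j) =
      ∑ j ∈ Finset.range N, rightLoop q e g N j (g j / ζ ^ k) := by
  rcases Nat.eq_zero_or_pos N with rfl | hN
  · simp
  have hmod : ∀ j, ζ ^ ((j + k) % N) = ζ ^ (j + k) := fun j => by
    conv_rhs => rw [← Nat.mod_add_div (j + k) N, pow_add, pow_mul, hζ.pow_eq_one, one_pow, mul_one]
  have hinj : Set.InjOn (fun j => (j + k) % N) (Finset.range N) := fun a ha b hb hab => by
    simp only [Finset.coe_range, Set.mem_Iio] at ha hb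
    have : a ≡ b [MOD N] := Nat.ModEq.add_right_cancel' k hab
    rwa [Nat.ModEq, Nat.mod_eq_of_lt ha, Nat.mod_eq_of_lt hb] at this
  have hmaps : Set.MapsTo (fun j => (j + k) % N) (Finset.range N) (Finset.range N) := fun a _ => by
    simpa using Nat.mod_lt _ hN
  refine Finset.sum_nbij (fun j => (j + k) % N) (fun a ha => hmaps ha) hinj
    (Finset.surjOn_of_injOn_of_card_le _ hmaps hinj le_rfl) fun j hj => ?_
  have e1 : ζ ^ k * g j = g ((j + k) % N) := by
    rw [hg, hg, pow_succ, pow_succ, hmod]; ring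
  have h0 : ζ ^ k ≠ 0 := pow_ne_zero _ (hζ.ne_zero hN.ne')
  rw [← e1, mul_div_cancel_left₀ _ h0, e1]
  exact h.leftLoop_eq_rightLoop hq hS hgS hNn (Nat.mod_lt _ hN) (Finset.mem_range.1 hj)

/-- The exchange identity extends from the roots of unity to all regular parameters. -/
theorem IsTemperleyLieb.sum_leftLoop_eq_sum_rightLoop (h : IsTemperleyLieb q n e) (hq : q ≠ 0)
    (hqN : q ^ N - q⁻¹ ^ N ≠ 0)
    (hS : IsRegularSet q S) (hNn : N ≤ n + 1) (hζ : IsPrimitiveRoot ζ N)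
    (hg : ∀ i, g i = ζ ^ (i + 1)) (hgS : ∀ i, g i ∈ S) {p : ℂ}
    (hp : (q * p) ^ N - q⁻¹ ^ N ≠ 0) :
    ∑ j ∈ Finset.range N, leftLoop q e g N j (p * g j) =
      ∑ j ∈ Finset.range N, rightLoop q e g N j (g j / p) := by
  rcases Nat.eq_zero_or_pos N with rfl | hN
  · simp
  have hg0 : ∀ i, g i ≠ 0 := fun i => hS.ne_zero _ (hgS i)
  have hlen : ∀ j ∈ Finset.range N, (linesBefore g j ++ linesAfter g N j).length = N - 1 := by
    intro j hj
    rw [List.length_append, length_linesBefore, length_linesAfter]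
    have := Finset.mem_range.1 hj
    omega
  have hmem0 : ∀ j, ∀ y ∈ linesBefore g j ++ linesAfter g N j, y ≠ 0 := fun j y hy =>
    hS.ne_zero _ (mem_linesBefore_append hgS N j y hy)
  have hL : ∀ j ∈ Finset.range N, ∃ φ : ℂ → A, IsPolynomialMap (N - 1) φ ∧
      ∀ p, (q * p) ^ N - q⁻¹ ^ N ≠ 0 →
        (((q * p) ^ N - q⁻¹ ^ N) / (q * p - q⁻¹)) • leftLoop q e g N j (p * g j) = φ p := by
    intro j hj
    obtain ⟨φ, hφ, hφe⟩ := exists_moveRight_polynomial (q := q) (e := e) (hg0 j) (hmem0 j) 0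
    rw [hlen j hj] at hφ
    refine ⟨_, hφ.const_mul_mul (moveLeft q e j (g j) (linesAfter g N j))
      (moveLeft q e 0 (g j) (linesBefore g j)), fun p hp => ?_⟩
    have hprod := prod_linesBefore_linesAfter (q := q) hζ hg (Finset.mem_range.1 hj) p
    rw [← hprod] at hp ⊢
    rw [mul_div_cancel_left₀ _ (left_ne_zero_of_mul hp), ← hφe p, leftLoop, mul_smul_comm,
      smul_mul_assoc]
    intro y hy h0
    exact right_ne_zero_of_mul hp (List.prod_eq_zero (h0 ▸ List.mem_map_of_mem hy))
  have hR : ∀ j ∈ Finset.range N, ∃ φ : ℂ → A, IsPolynomialMap (N - 1) φ ∧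
      ∀ p, (q * p) ^ N - q⁻¹ ^ N ≠ 0 →
        (((q * p) ^ N - q⁻¹ ^ N) / (q * p - q⁻¹)) • rightLoop q e g N j (g j / p) = φ p := by
    intro j hj
    obtain ⟨φ, hφ, hφe⟩ := exists_moveLeft_polynomial (q := q) (e := e) (hg0 j) (hmem0 j) 0
    rw [hlen j hj] at hφ
    refine ⟨_, hφ.const_mul_mul (moveRight q e 0 (g j) (linesBefore g j))
      (moveRight q e j (g j) (linesAfter g N j)), fun p hp => ?_⟩
    have hprod := prod_linesBefore_linesAfter_inv (q := q) hζ hg (Finset.mem_range.1 hj) p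
    rw [← hprod] at hp ⊢
    rw [mul_div_cancel_left₀ _ (left_ne_zero_of_mul hp), ← hφe p, rightLoop, mul_smul_comm,
      smul_mul_assoc]
    intro y hy h0
    exact right_ne_zero_of_mul hp (List.prod_eq_zero (h0 ▸ List.mem_map_of_mem hy))
  choose! φ hφ hφe using hL
  choose! ψ hψ hψe using hR
  have hsub : ∀ p, (q * p) ^ N - q⁻¹ ^ N ≠ 0 →
      (∑ j ∈ Finset.range N, φ j p) - ∑ j ∈ Finset.range N, ψ j p =
        (((q * p) ^ N - q⁻¹ ^ N) / (q * p - q⁻¹)) •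
          (∑ j ∈ Finset.range N, leftLoop q e g N j (p * g j) -
            ∑ j ∈ Finset.range N, rightLoop q e g N j (g j / p)) := by
    intro p hp
    rw [smul_sub, Finset.smul_sum, Finset.smul_sum]
    congr 1
    · exact Finset.sum_congr rfl fun j hj => (hφe j hj p hp).symm
    · exact Finset.sum_congr rfl fun j hj => (hψe j hj p hp).symm
  have hzero := ((IsPolynomialMap.sum _ hφ).sub (IsPolynomialMap.sum _ hψ)).eq_zero
    (Polynomial.nthRootsFinset N 1) (by rw [hζ.card_nthRootsFinset]; omega) (fun x hx => by
      have : NeZero N := ⟨hN.ne'⟩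
      obtain ⟨k, -, rfl⟩ := hζ.eq_pow_of_pow_eq_one ((Polynomial.mem_nthRootsFinset hN _).1 hx)
      have hk : (q * ζ ^ k) ^ N - q⁻¹ ^ N ≠ 0 := by
        rwa [mul_pow, ← pow_mul, mul_comm k, pow_mul, hζ.pow_eq_one, one_pow, mul_one]
      rw [hsub _ hk, sum_leftLoop_eq_sum_rightLoop_of_pow h hq hS hNn hζ hg hgS, sub_self,
        smul_zero]) p
  have hfac := prod_linesBefore_linesAfter (q := q) hζ hg hN p
  rw [hsub p hp, smul_eq_zero, sub_eq_zero] at hzero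
  exact hzero.resolve_left (div_ne_zero hp (left_ne_zero_of_mul (hfac.trans_ne hp)))

end RootsOfUnity

/-! ### Relations between the interactions and the moves -/

theorem IsTemperleyLieb.leftSum_mul_moveRight (h : IsTemperleyLieb q n e) (hq : q ≠ 0)
    (hS : IsRegularSet q S) {w : ℂ} (hw : w ∈ S) {ys : List ℂ} (hys : ∀ y ∈ ys, y ∈ S) (a : ℕ) :
    leftSum q e a w ys * moveRight q e a w ys = moveRight q e a w ys * rightSum q e a w ys := by
  induction ys generalizing a with
  | nil => simp [leftSum, rightSum]
  | cons y ys ih =>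
    simp only [List.mem_cons, forall_eq_or_imp] at hys
    have hinv := h.bax_mul_bax_inv hq hS hw hys.1 a
    have hinv' := h.moveLeft_mul_moveRight hq hS hw hys.2 (a + 1)
    have hpot : pot q y w = pot q w y := by unfold pot; ring
    have hcomm : e a * bax q e a (w / y) = bax q e a (w / y) * e a := by
      simp [bax, mul_sub, sub_mul]
    simp only [leftSum, rightSum, moveRight, add_mul, mul_add, smul_mul_assoc, mul_smul_comm]
    congr 1
    · calc _ = pot q y w • (moveRight q e (a + 1) w ys * e a * (moveLeft q e (a + 1) w ys *
          moveRight q e (a + 1) w ys) * bax q e a (w / y)) := by simp only [mul_assoc]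
        _ = _ := by rw [hinv', hpot, mul_one, mul_assoc, hcomm, mul_assoc]
    · calc _ = leftSum q e (a + 1) w ys * moveRight q e (a + 1) w ys * bax q e a (w / y) := by
            rw [mul_assoc]
        _ = moveRight q e (a + 1) w ys * (bax q e a (w / y) * bax q e a (y / w)) *
            rightSum q e (a + 1) w ys * bax q e a (w / y) := by rw [ih hys.2, hinv, mul_one]
        _ = _ := by simp only [mul_assoc]

theorem IsTemperleyLieb.moveLeft_mul_leftSum (h : IsTemperleyLieb q n e) (hq : q ≠ 0)
    (hS : IsRegularSet q S) {w : ℂ} (hw : w ∈ S) {ys : List ℂ} (hys : ∀ y ∈ ys, y ∈ S) (a : ℕ) :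
    moveLeft q e a w ys * leftSum q e a w ys = rightSum q e a w ys * moveLeft q e a w ys := by
  have h1 := h.moveRight_mul_moveLeft hq hS hw hys a
  have h2 := h.moveLeft_mul_moveRight hq hS hw hys a
  calc _ = moveLeft q e a w ys * (leftSum q e a w ys * moveRight q e a w ys) *
        moveLeft q e a w ys := by simp only [mul_assoc, h1, mul_one]
    _ = _ := by
      rw [h.leftSum_mul_moveRight hq hS hw hys, ← mul_assoc (moveLeft q e a w ys), h2, one_mul]

theorem leftSum_append_singleton (a : ℕ) (w y : ℂ) (ys : List ℂ) :
    leftSum q e a w (ys ++ [y]) = pot q y w • e (a + ys.length) +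
      bax q e (a + ys.length) (w / y) * leftSum q e a w ys * bax q e (a + ys.length) (y / w) := by
  induction ys generalizing a with
  | nil => simp [leftSum, moveRight, moveLeft]
  | cons x xs ih =>
    have e1 : a + (xs.length + 1) = a + 1 + xs.length := by omega
    simp only [List.cons_append, leftSum, ih, List.length_cons, e1, moveRight_append,
      moveLeft_append, moveRight, moveLeft, one_mul, mul_one, mul_add, add_mul, mul_smul_comm,
      smul_mul_assoc, mul_assoc]
    abel

theorem moveRight_smul {c : ℂ} (hc : c ≠ 0) (a : ℕ) (w : ℂ) (ys : List ℂ) :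
    moveRight q e a (w * c) (ys.map (· * c)) = moveRight q e a w ys := by
  induction ys generalizing a with
  | nil => simp [moveRight]
  | cons y ys ih => simp [moveRight, ih, mul_div_mul_right _ _ hc]

theorem moveLeft_smul {c : ℂ} (hc : c ≠ 0) (a : ℕ) (w : ℂ) (ys : List ℂ) :
    moveLeft q e a (w * c) (ys.map (· * c)) = moveLeft q e a w ys := by
  induction ys generalizing a with
  | nil => simp [moveLeft]
  | cons y ys ih => simp [moveLeft, ih, mul_div_mul_right _ _ hc]

theorem leftSum_smul {c : ℂ} (hc : c ≠ 0) (a : ℕ) (w : ℂ) (ys : List ℂ) :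
    leftSum q e a (w * c) (ys.map (· * c)) = leftSum q e a w ys := by
  have hpot : ∀ y, pot q (y * c) (w * c) = pot q y w := fun y => by
    unfold pot
    rw [← mul_div_mul_left (y * w) _ (mul_ne_zero hc hc)]
    congr 1 <;> ring
  induction ys generalizing a with
  | nil => simp [leftSum]
  | cons y ys ih =>
    simp only [List.map_cons, leftSum, ih, hpot, moveRight_smul hc, moveLeft_smul hc]

theorem totalLeft_smul {c : ℂ} (hc : c ≠ 0) (pre ws : List ℂ) :
    totalLeft q e (pre.map (· * c)) (ws.map (· * c)) = totalLeft q e pre ws := by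
  induction ws generalizing pre with
  | nil => simp [totalLeft]
  | cons w ws ih =>
    have := ih (pre ++ [w])
    rw [List.map_append, List.map_singleton] at this
    rw [List.map_cons, totalLeft, totalLeft, this, leftSum_smul hc]

theorem commute_totalLeft {b : A} (pre ws : List ℂ)
    (hb : ∀ k, k + 1 < pre.length + ws.length → Commute b (e k)) :
    Commute b (totalLeft q e pre ws) := by
  induction ws generalizing pre with
  | nil => exact Commute.zero_right _
  | cons w ws ih =>
    simp only [List.length_cons] at hb
    refine Commute.add_right (commute_leftSum _ _ fun k hk => hb k (by omega)) (ih _ fun k hk => ?_)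
    simp only [List.length_append, List.length_singleton] at hk
    exact hb k (by omega)

theorem IsTemperleyLieb.e_mul_bax (h : IsTemperleyLieb q n e) {x y : ℂ} (hy : y ≠ 0)
    (hxy : q * x - q⁻¹ * y ≠ 0) (k : ℕ) :
    e k * bax q e k (x / y) = ((q * y - q⁻¹ * x) / (q * x - q⁻¹ * y)) • e k := by
  have : (q * y - q⁻¹ * x) / (q * x - q⁻¹ * y) = 1 - fR q (x / y) * (q + q⁻¹) := by
    rw [fR_div hy, eq_sub_iff_add_eq, div_mul_eq_mul_div, ← add_div, div_eq_one_iff_eq hxy]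
    ring
  rw [this, bax, mul_sub, mul_one, mul_smul_comm, h.sq]
  module

end Algebra

/-! ### Derivatives of the moves -/

section Calculus

open Filter Topology

variable {A : Type*} [NormedRing A] [NormedAlgebra ℂ A]
variable {q : ℂ} {n : ℕ} {e : ℕ → A} {S : Set ℂ}

theorem IsTemperleyLieb.hasDerivAt_bax_div_const (h : IsTemperleyLieb q n e) (hq : q ≠ 0)
    (hS : IsRegularSet q S) {w : ℂ → ℂ} {s c y : ℂ} (hw : HasDerivAt w (c * w s) s)
    (hws : w s ∈ S) (hy : y ∈ S) (k : ℕ) :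
    HasDerivAt (fun s => bax q e k (w s / y))
      (-(c * (q - q⁻¹)) • (pot q y (w s) • (e k * bax q e k (w s / y)))) s := by
  have h1 := hS.no_pole _ hws y hy
  have h2 := hS.no_pole y hy _ hws
  rw [h.e_mul_bax (hS.ne_zero y hy) h1]
  simp only [bax, fR_div (hS.ne_zero y hy)]
  have hd := ((hw.sub_const y).fun_div ((hw.const_mul q).sub_const (q⁻¹ * y)) h1).smul_const (e k)
  refine (hd.const_sub 1).congr_deriv ?_
  rw [smul_smul, smul_smul, ← neg_smul]
  congr 1
  rw [show c * w s * (q * w s - q⁻¹ * y) - (w s - y) * (q * (c * w s)) =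
    c * (q - q⁻¹) * (y * w s) by ring, pot]
  generalize q * w s - q⁻¹ * y = d₁ at *
  generalize q * y - q⁻¹ * w s = d₂ at *
  field_simp

theorem IsTemperleyLieb.hasDerivAt_bax_const_div (h : IsTemperleyLieb q n e) (hq : q ≠ 0)
    (hS : IsRegularSet q S) {w : ℂ → ℂ} {s c y : ℂ} (hw : HasDerivAt w (c * w s) s)
    (hws : w s ∈ S) (hw0 : ∀ s, w s ≠ 0) (hy : y ∈ S) (k : ℕ) :
    HasDerivAt (fun s => bax q e k (y / w s))
      ((c * (q - q⁻¹)) • (pot q y (w s) • (e k * bax q e k (y / w s)))) s := by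
  have h1 := hS.no_pole _ hws y hy
  have h2 := hS.no_pole y hy _ hws
  rw [h.e_mul_bax (hS.ne_zero _ hws) h2]
  simp only [bax, fR_div (hw0 _)]
  have hd := ((hw.const_sub y).fun_div ((hw.const_mul q⁻¹).const_sub (q * y)) h2).smul_const (e k)
  refine (hd.const_sub 1).congr_deriv ?_
  rw [smul_smul, smul_smul, ← neg_smul]
  congr 1
  rw [show -(c * w s) * (q * y - q⁻¹ * w s) - (y - w s) * -(q⁻¹ * (c * w s)) =
    -(c * (q - q⁻¹) * (y * w s)) by ring, pot]
  generalize q * w s - q⁻¹ * y = d₁ at *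
  generalize q * y - q⁻¹ * w s = d₂ at *
  field_simp

theorem IsTemperleyLieb.hasDerivAt_moveRight (h : IsTemperleyLieb q n e) (hq : q ≠ 0)
    (hS : IsRegularSet q S) {w : ℂ → ℂ} {s c : ℂ} (hw : HasDerivAt w (c * w s) s)
    (hws : w s ∈ S) {ys : List ℂ} (hys : ∀ y ∈ ys, y ∈ S) (a : ℕ) :
    HasDerivAt (fun s => moveRight q e a (w s) ys)
      (-(c * (q - q⁻¹)) • (leftSum q e a (w s) ys * moveRight q e a (w s) ys)) s := by
  induction ys generalizing a with
  | nil => simpa [moveRight, leftSum] using hasDerivAt_const s (1 : A)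
  | cons y ys ih =>
    simp only [List.mem_cons, forall_eq_or_imp] at hys
    have hinv := h.moveLeft_mul_moveRight hq hS hws hys.2 (a + 1)
    simp only [moveRight]
    refine ((ih hys.2 (a + 1)).mul
      (h.hasDerivAt_bax_div_const hq hS hw hws hys.1 a)).congr_deriv ?_
    have key : moveRight q e (a + 1) (w s) ys * e a * moveLeft q e (a + 1) (w s) ys *
        (moveRight q e (a + 1) (w s) ys * bax q e a (w s / y)) =
        moveRight q e (a + 1) (w s) ys * (e a * bax q e a (w s / y)) := by
      rw [mul_assoc, ← mul_assoc (moveLeft q e _ _ _), hinv, one_mul, mul_assoc]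
    simp only [leftSum, add_mul, smul_mul_assoc, mul_smul_comm, smul_add, key]
    rw [add_comm, mul_assoc]

theorem IsTemperleyLieb.hasDerivAt_moveLeft (h : IsTemperleyLieb q n e) (hq : q ≠ 0)
    (hS : IsRegularSet q S) {w : ℂ → ℂ} {s c : ℂ} (hw : HasDerivAt w (c * w s) s)
    (hws : w s ∈ S) (hw0 : ∀ s, w s ≠ 0) {ys : List ℂ} (hys : ∀ y ∈ ys, y ∈ S) (a : ℕ) :
    HasDerivAt (fun s => moveLeft q e a (w s) ys)
      ((c * (q - q⁻¹)) • (moveLeft q e a (w s) ys * leftSum q e a (w s) ys)) s := by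
  induction ys generalizing a with
  | nil => simpa [moveLeft, leftSum] using hasDerivAt_const s (1 : A)
  | cons y ys ih =>
    simp only [List.mem_cons, forall_eq_or_imp] at hys
    have hinv := h.moveLeft_mul_moveRight hq hS hws hys.2 (a + 1)
    have hcomm : e a * bax q e a (y / w s) = bax q e a (y / w s) * e a := by
      simp [bax, mul_sub, sub_mul]
    simp only [moveLeft]
    refine ((h.hasDerivAt_bax_const_div hq hS hw hws hw0 hys.1 a).mul
      (ih hys.2 (a + 1))).congr_deriv ?_
    have key : bax q e a (y / w s) * moveLeft q e (a + 1) (w s) ys *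
        (moveRight q e (a + 1) (w s) ys * e a * moveLeft q e (a + 1) (w s) ys) =
        bax q e a (y / w s) * e a * moveLeft q e (a + 1) (w s) ys := by
      rw [mul_assoc, mul_assoc (moveRight q e _ _ _), ← mul_assoc (moveLeft q e _ _ _), hinv,
        one_mul, mul_assoc]
    simp only [leftSum, mul_add, smul_mul_assoc, mul_smul_comm, smul_add, hcomm, key]
    rw [mul_assoc _ (moveLeft q e _ _ _) (leftSum q e _ _ _)]

/-! ### Differentiability of the interactions -/

section Differentiability

variable {E : Type*} [NormedAddCommGroup E] [NormedSpace ℂ E] {ι : Type*} {x : E}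

theorem differentiableAt_bax (hS : IsRegularSet q S) {v w : E → ℂ} (hv : DifferentiableAt ℂ v x)
    (hw : DifferentiableAt ℂ w x) (hvS : v x ∈ S) (hwS : w x ∈ S) (hw0 : ∀ x, w x ≠ 0) (k : ℕ) :
    DifferentiableAt ℂ (fun x => bax q e k (v x / w x)) x := by
  simp only [bax, fR_div (hw0 _)]
  have := hS.no_pole _ hvS _ hwS
  fun_prop (disch := assumption)

variable {w : E → ℂ} {G : ι → E → ℂ}

theorem differentiableAt_moveRight (hS : IsRegularSet q S) (hw : DifferentiableAt ℂ w x)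
    (hwS : w x ∈ S) (hG : ∀ i, DifferentiableAt ℂ (G i) x) (hGS : ∀ i, G i x ∈ S)
    (hG0 : ∀ i x, G i x ≠ 0) (l : List ι) (a : ℕ) :
    DifferentiableAt ℂ (fun x => moveRight q e a (w x) (l.map fun i => G i x)) x := by
  induction l generalizing a with
  | nil => exact differentiableAt_const _
  | cons i l ih => exact (ih (a + 1)).mul (differentiableAt_bax hS hw (hG i) hwS (hGS i) (hG0 i) a)

theorem differentiableAt_moveLeft (hS : IsRegularSet q S) (hw : DifferentiableAt ℂ w x)
    (hwS : w x ∈ S) (hw0 : ∀ x, w x ≠ 0) (hG : ∀ i, DifferentiableAt ℂ (G i) x)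
    (hGS : ∀ i, G i x ∈ S) (l : List ι) (a : ℕ) :
    DifferentiableAt ℂ (fun x => moveLeft q e a (w x) (l.map fun i => G i x)) x := by
  induction l generalizing a with
  | nil => exact differentiableAt_const _
  | cons i l ih => exact (differentiableAt_bax hS (hG i) hw (hGS i) hwS hw0 a).mul (ih (a + 1))

theorem differentiableAt_leftSum (hS : IsRegularSet q S) (hw : DifferentiableAt ℂ w x)
    (hwS : w x ∈ S) (hw0 : ∀ x, w x ≠ 0) (hG : ∀ i, DifferentiableAt ℂ (G i) x)
    (hGS : ∀ i, G i x ∈ S) (hG0 : ∀ i x, G i x ≠ 0) (l : List ι) (a : ℕ) :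
    DifferentiableAt ℂ (fun x => leftSum q e a (w x) (l.map fun i => G i x)) x := by
  induction l generalizing a with
  | nil => exact differentiableAt_const _
  | cons i l ih =>
    refine DifferentiableAt.fun_add (DifferentiableAt.fun_smul ?_
      (((differentiableAt_moveRight hS hw hwS hG hGS hG0 l (a + 1)).mul_const _).mul
        (differentiableAt_moveLeft hS hw hwS hw0 hG hGS l (a + 1))))
      (ih (a + 1))
    have h1 := mul_ne_zero (hS.no_pole _ (hGS i) _ hwS) (hS.no_pole _ hwS _ (hGS i))
    have h2 := hG i
    unfold pot
    fun_prop (disch := assumption)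

theorem differentiableAt_totalLeft (hS : IsRegularSet q S) (hG : ∀ i, DifferentiableAt ℂ (G i) x)
    (hGS : ∀ i, G i x ∈ S) (hG0 : ∀ i x, G i x ≠ 0) (l l' : List ι) :
    DifferentiableAt ℂ
      (fun x => totalLeft q e (l.map fun i => G i x) (l'.map fun i => G i x)) x := by
  induction l' generalizing l with
  | nil => exact differentiableAt_const _
  | cons i l' ih =>
    have := ih (l ++ [i])
    simp only [List.map_append, List.map_singleton] at this
    exact (differentiableAt_leftSum hS (hG i) (hGS i) (hG0 i) hG hGS hG0 l 0).add this

end Differentiability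

/-- Regularity is preserved under small deformations of one additional parameter. -/
theorem IsRegularSet.eventually_insert (hS : IsRegularSet q S) {w : ℂ → ℂ} (hw : ContinuousAt w 0)
    (hwS : w 0 ∈ S) : ∀ᶠ s in 𝓝 0, IsRegularSet q (insert (w s) S) := by
  have h0 : ∀ᶠ s in 𝓝 0, w s ≠ 0 := hw.eventually_ne (hS.ne_zero _ hwS)
  have hself : ∀ᶠ s in 𝓝 0, q * w s - q⁻¹ * w s ≠ 0 :=
    ContinuousAt.eventually_ne (by fun_prop) (hS.no_pole _ hwS _ hwS)
  have hr : ∀ᶠ s in 𝓝 0, ∀ y ∈ S, q * w s - q⁻¹ * y ≠ 0 :=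
    (eventually_all_finite hS.finite).2 fun y hy =>
      ContinuousAt.eventually_ne (by fun_prop) (hS.no_pole _ hwS _ hy)
  have hl : ∀ᶠ s in 𝓝 0, ∀ y ∈ S, q * y - q⁻¹ * w s ≠ 0 :=
    (eventually_all_finite hS.finite).2 fun y hy =>
      ContinuousAt.eventually_ne (by fun_prop) (hS.no_pole _ hy _ hwS)
  filter_upwards [h0, hself, hr, hl] with s h0 hself hr hl
  refine ⟨hS.finite.insert _, ?_, ?_⟩
  · rintro x (rfl | hx)
    exacts [h0, hS.ne_zero x hx]
  · rintro x (rfl | hx) y (rfl | hy)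
    exacts [hself, hr y hy, hl x hx, hS.no_pole x hx y hy]

/-! ### Covariance of the left Hamiltonian -/

theorem hasDerivAt_exp_mul (v s : ℂ) :
    HasDerivAt (fun s => Complex.exp s * v) (1 * (Complex.exp s * v)) s := by
  rw [one_mul]
  exact (Complex.hasDerivAt_exp s).mul_const v

theorem hasDerivAt_div_exp (v s : ℂ) :
    HasDerivAt (fun s => v / Complex.exp s) (-1 * (v / Complex.exp s)) s := by
  have := ((hasDerivAt_neg s).cexp).const_mul v
  simp only [Complex.exp_neg, ← div_eq_mul_inv] at this
  refine this.congr_deriv ?_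
  ring

theorem IsRegularSet.sub_inv_ne_zero (hS : IsRegularSet q S) {x : ℂ} (hx : x ∈ S) :
    q - q⁻¹ ≠ 0 := by
  have := hS.no_pole x hx x hx
  rw [← sub_mul] at this
  exact left_ne_zero_of_mul this

theorem IsRegularSet.eventually_insert_exp_mul (hS : IsRegularSet q S) {w : ℂ} (hw : w ∈ S) :
    ∀ᶠ s in 𝓝 0, IsRegularSet q (insert (Complex.exp s * w) S) :=
  hS.eventually_insert (hasDerivAt_exp_mul w 0).continuousAt (by simpa using hw)

/-- The interactions of a line are covariant under exchanging two neighbouring lines to its left. -/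
theorem IsTemperleyLieb.leftSum_swap (h : IsTemperleyLieb q n e) (hq : q ≠ 0)
    (hS : IsRegularSet q S) {w x y : ℂ} (hw : w ∈ S) (hx : x ∈ S) (hy : y ∈ S) {pre post : List ℂ}
    (hpre : ∀ y ∈ pre, y ∈ S) (hpost : ∀ y ∈ post, y ∈ S)
    {a : ℕ} (ha : a + pre.length + 1 < n) :
    leftSum q e a w (pre ++ x :: y :: post) * bax q e (a + pre.length) (y / x) =
      bax q e (a + pre.length) (y / x) * leftSum q e a w (pre ++ y :: x :: post) := by
  have hxy : ∀ t ∈ pre ++ x :: y :: post, t ∈ S := by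
    simp only [List.mem_append, List.mem_cons]; grind
  have hyx : ∀ t ∈ pre ++ y :: x :: post, t ∈ S := by
    simp only [List.mem_append, List.mem_cons]; grind
  have hw0 : Complex.exp 0 * w ∈ S := by simpa using hw
  have hev : (fun s => moveRight q e a (Complex.exp s * w) (pre ++ x :: y :: post) *
      bax q e (a + pre.length + 1) (y / x)) =ᶠ[𝓝 0] fun s => bax q e (a + pre.length) (y / x) *
        moveRight q e a (Complex.exp s * w) (pre ++ y :: x :: post) := by
    filter_upwards [hS.eventually_insert_exp_mul hw] with s hs
    exact h.moveRight_swap hq hs (Set.mem_insert _ _) (Set.mem_insert_of_mem _ hx)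
      (Set.mem_insert_of_mem _ hy) _ _ ha
  have hd := ((h.hasDerivAt_moveRight hq hS (hasDerivAt_exp_mul w 0) hw0 hxy a).mul_const
    (bax q e (a + pre.length + 1) (y / x))).unique
    (((h.hasDerivAt_moveRight hq hS (hasDerivAt_exp_mul w 0) hw0 hyx a).const_mul
      (bax q e (a + pre.length) (y / x))).congr_of_eventuallyEq hev)
  have hκ : -(1 * (q - q⁻¹)) ≠ 0 := by
    rw [one_mul]; exact neg_ne_zero.2 (hS.sub_inv_ne_zero hw)
  simp only [Complex.exp_zero, one_mul] at hd hκ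
  rw [smul_mul_assoc, mul_smul_comm] at hd
  have hd' := smul_right_injective A hκ hd
  simp only [mul_assoc, h.moveRight_swap hq hS hw hx hy pre post ha] at hd'
  have hinv := h.moveRight_mul_moveLeft hq hS hw hyx a
  have := congrArg (· * moveLeft q e a w (pre ++ y :: x :: post)) hd'
  simpa only [mul_assoc, hinv, mul_one] using this

theorem IsTemperleyLieb.totalLeft_swap_post (h : IsTemperleyLieb q n e) (hq : q ≠ 0)
    (hS : IsRegularSet q S) {x y : ℂ} (hx : x ∈ S) (hy : y ∈ S) {pre mid post : List ℂ}
    (hpre : ∀ y ∈ pre, y ∈ S) (hmid : ∀ y ∈ mid, y ∈ S) (hpost : ∀ y ∈ post, y ∈ S)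
    (hn : pre.length + mid.length + post.length < n) :
    totalLeft q e (pre ++ x :: y :: mid) post * bax q e pre.length (y / x) =
      bax q e pre.length (y / x) * totalLeft q e (pre ++ y :: x :: mid) post := by
  induction post generalizing mid with
  | nil => simp [totalLeft]
  | cons w post ih =>
    simp only [List.mem_cons, forall_eq_or_imp] at hpost
    simp only [List.length_cons] at hn
    have hmid' : ∀ y ∈ mid ++ [w], y ∈ S := by
      simp only [List.mem_append, List.mem_singleton]; grind
    have h1 := h.leftSum_swap hq hS hpost.1 hx hy hpre hmid (a := 0) (by omega)
    have h2 := ih hmid' hpost.2 (by simp only [List.length_append, List.length_singleton]; omega)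
    rw [Nat.zero_add] at h1
    simp only [totalLeft, add_mul, mul_add, List.append_assoc, List.cons_append, h1, h2]

/-- The left Hamiltonian is covariant under exchanging two neighbouring lines. -/
theorem IsTemperleyLieb.totalLeft_swap (h : IsTemperleyLieb q n e) (hq : q ≠ 0)
    (hS : IsRegularSet q S) {x y : ℂ} (hx : x ∈ S) (hy : y ∈ S) {pre post : List ℂ}
    (hpre : ∀ y ∈ pre, y ∈ S) (hpost : ∀ y ∈ post, y ∈ S) (hn : pre.length + post.length < n) :
    totalLeft q e [] (pre ++ x :: y :: post) * bax q e pre.length (y / x) =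
      bax q e pre.length (y / x) * totalLeft q e [] (pre ++ y :: x :: post) := by
  set B := bax q e pre.length (y / x) with hB
  have h1 := h.totalLeft_swap_post hq hS hx hy hpre (mid := []) (by simp) hpost (by simpa using hn)
  have h2 : Commute B (totalLeft q e [] pre) :=
    commute_totalLeft _ _ fun k hk => by
      simp only [List.length_nil] at hk
      exact (h.commute_e_bax (by omega) _).symm
  have hinv := h.bax_mul_bax_inv hq hS hx hy pre.length
  have hinv' := h.bax_mul_bax_inv hq hS hy hx pre.length
  have hpot : pot q x y = pot q y x := by unfold pot; ring
  have hcomm : B * e pre.length = e pre.length * B := by simp [hB, bax, mul_sub, sub_mul]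
  rw [← hB] at h1 hinv hinv'
  simp only [totalLeft_append, totalLeft, List.nil_append, leftSum_append_singleton, add_mul,
    mul_add, List.append_assoc, List.cons_append, h1, h2.eq, Nat.zero_add, ← hB]
  rw [← hpot, smul_mul_assoc, mul_smul_comm, hcomm]
  have e1 : B * leftSum q e 0 y pre * bax q e pre.length (x / y) * B = B * leftSum q e 0 y pre := by
    rw [mul_assoc, hinv, mul_one]
  have e2 : B * (bax q e pre.length (x / y) * leftSum q e 0 x pre * B) =
      leftSum q e 0 x pre * B := by
    rw [← mul_assoc, ← mul_assoc, hinv', one_mul]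
  rw [e1, e2]
  abel

/-- Carrying a line to the right end conjugates the left Hamiltonian. -/
theorem IsTemperleyLieb.totalLeft_mul_moveLeft (h : IsTemperleyLieb q n e) (hq : q ≠ 0)
    (hS : IsRegularSet q S) {w : ℂ} (hw : w ∈ S) {pre ys : List ℂ}
    (hpre : ∀ y ∈ pre, y ∈ S) (hys : ∀ y ∈ ys, y ∈ S) (hn : pre.length + ys.length ≤ n) :
    totalLeft q e [] (pre ++ w :: ys) * moveLeft q e pre.length w ys =
      moveLeft q e pre.length w ys * totalLeft q e [] (pre ++ ys ++ [w]) := by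
  induction ys generalizing pre with
  | nil => simp [moveLeft]
  | cons y ys ih =>
    simp only [List.mem_cons, forall_eq_or_imp] at hys
    simp only [List.length_cons] at hn
    have hpre' : ∀ t ∈ pre ++ [y], t ∈ S := by
      simp only [List.mem_append, List.mem_singleton]; grind
    have h1 := h.totalLeft_swap hq hS hw hys.1 hpre hys.2 (by omega)
    have h2 := ih hpre' hys.2 (by simp only [List.length_append, List.length_singleton]; omega)
    simp only [List.length_append, List.length_singleton, List.append_assoc, List.cons_append,
      List.nil_append] at h2 ⊢
    rw [moveLeft, ← mul_assoc, h1, mul_assoc, h2, mul_assoc]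

/-- The left Hamiltonian in terms of the interactions of one line carried to the right end. -/
theorem IsTemperleyLieb.totalLeft_eq_conj (h : IsTemperleyLieb q n e) (hq : q ≠ 0)
    (hS : IsRegularSet q S) {w : ℂ} (hw : w ∈ S) {pre ys : List ℂ}
    (hpre : ∀ y ∈ pre, y ∈ S) (hys : ∀ y ∈ ys, y ∈ S) (hn : pre.length + ys.length ≤ n) :
    totalLeft q e [] (pre ++ w :: ys) = moveLeft q e pre.length w ys *
      (totalLeft q e [] (pre ++ ys) + leftSum q e 0 w (pre ++ ys)) *
        moveRight q e pre.length w ys := by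
  have h1 := h.totalLeft_mul_moveLeft hq hS hw hpre hys hn
  have hinv := h.moveLeft_mul_moveRight hq hS hw hys pre.length
  rw [totalLeft_append [] (pre ++ ys) [w], List.nil_append, totalLeft, totalLeft, add_zero] at h1
  rw [← h1, mul_assoc, hinv, mul_one]

/-! ### The Hamiltonians commute -/

theorem IsTemperleyLieb.hasDerivAt_totalLeft_line (h : IsTemperleyLieb q n e) (hq : q ≠ 0)
    (hS : IsRegularSet q S) {v : ℂ} (hv : v ∈ S) {pre ys : List ℂ}
    (hpre : ∀ y ∈ pre, y ∈ S) (hys : ∀ y ∈ ys, y ∈ S) (hn : pre.length + ys.length ≤ n) {m' : A}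
    (hm : HasDerivAt (fun s => leftSum q e 0 (Complex.exp s * v) (pre ++ ys)) m' 0) :
    HasDerivAt (fun s => totalLeft q e [] (pre ++ Complex.exp s * v :: ys))
      ((q - q⁻¹) • (rightSum q e pre.length v ys * totalLeft q e [] (pre ++ v :: ys) -
        totalLeft q e [] (pre ++ v :: ys) * rightSum q e pre.length v ys) +
          moveLeft q e pre.length v ys * m' * moveRight q e pre.length v ys) 0 := by
  have hv0 : Complex.exp 0 * v ∈ S := by simpa using hv
  have hev : (fun s => totalLeft q e [] (pre ++ Complex.exp s * v :: ys)) =ᶠ[𝓝 0] fun s =>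
      moveLeft q e pre.length (Complex.exp s * v) ys *
      (totalLeft q e [] (pre ++ ys) + leftSum q e 0 (Complex.exp s * v) (pre ++ ys)) *
        moveRight q e pre.length (Complex.exp s * v) ys := by
    filter_upwards [hS.eventually_insert_exp_mul hv] with s hs
    exact h.totalLeft_eq_conj hq hs (Set.mem_insert _ _)
      (fun y hy => Set.mem_insert_of_mem _ (hpre y hy))
      (fun y hy => Set.mem_insert_of_mem _ (hys y hy)) hn
  have hL := h.hasDerivAt_moveLeft hq hS (hasDerivAt_exp_mul v 0) hv0
    (fun s => mul_ne_zero (Complex.exp_ne_zero s) (hS.ne_zero v hv)) hys pre.length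
  have hR := h.hasDerivAt_moveRight hq hS (hasDerivAt_exp_mul v 0) hv0 hys pre.length
  refine HasDerivAt.congr_of_eventuallyEq ?_ hev
  refine ((hL.fun_mul (hm.const_add (totalLeft q e [] (pre ++ ys)))).fun_mul hR).congr_deriv ?_
  simp only [Complex.exp_zero, one_mul]
  rw [h.moveLeft_mul_leftSum hq hS hv hys, h.leftSum_mul_moveRight hq hS hv hys,
    h.totalLeft_eq_conj hq hS hv hpre hys hn]
  simp only [add_mul, mul_add, mul_assoc, smul_mul_assoc, mul_smul_comm, neg_smul, smul_sub,
    smul_add, mul_neg, neg_add]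
  abel

section Loops

variable {g : ℕ → ℂ} {N : ℕ}

theorem IsTemperleyLieb.hasDerivAt_leftLoop (h : IsTemperleyLieb q n e) (hq : q ≠ 0)
    (hg : ∀ i, g i ∈ S) {j : ℕ} {s : ℂ}
    (hs : IsRegularSet q (insert (Complex.exp s * g j) S)) :
    HasDerivAt (fun s => leftLoop q e g N j (Complex.exp s * g j))
      (-(q - q⁻¹) • (moveLeft q e j (g j) (linesAfter g N j) *
        (leftSum q e 0 (Complex.exp s * g j) (linesBefore g j ++ linesAfter g N j) *
        moveRight q e 0 (Complex.exp s * g j) (linesBefore g j ++ linesAfter g N j)) *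
          moveLeft q e 0 (g j) (linesBefore g j))) s := by
  have := h.hasDerivAt_moveRight hq hs (hasDerivAt_exp_mul (g j) s) (Set.mem_insert _ _)
    (mem_linesBefore_append (fun i => Set.mem_insert_of_mem _ (hg i)) N j) 0
  refine ((this.const_mul (moveLeft q e j (g j) (linesAfter g N j))).mul_const
    (moveLeft q e 0 (g j) (linesBefore g j))).congr_deriv ?_
  rw [mul_smul_comm, smul_mul_assoc, one_mul]

theorem IsTemperleyLieb.hasDerivAt_rightLoop (h : IsTemperleyLieb q n e) (hq : q ≠ 0)
    (hS : IsRegularSet q S) (hg : ∀ i, g i ∈ S) {j : ℕ} {s : ℂ}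
    (hs : IsRegularSet q (insert (g j / Complex.exp s) S)) :
    HasDerivAt (fun s => rightLoop q e g N j (g j / Complex.exp s))
      (-(q - q⁻¹) • (moveRight q e 0 (g j) (linesBefore g j) *
        (moveLeft q e 0 (g j / Complex.exp s) (linesBefore g j ++ linesAfter g N j) *
        leftSum q e 0 (g j / Complex.exp s) (linesBefore g j ++ linesAfter g N j)) *
          moveRight q e j (g j) (linesAfter g N j))) s := by
  have := h.hasDerivAt_moveLeft hq hs (hasDerivAt_div_exp (g j) s) (Set.mem_insert _ _)
    (fun s => div_ne_zero (hS.ne_zero _ (hg j)) (Complex.exp_ne_zero s))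
    (mem_linesBefore_append (fun i => Set.mem_insert_of_mem _ (hg i)) N j) 0
  refine ((this.const_mul (moveRight q e 0 (g j) (linesBefore g j))).mul_const
    (moveRight q e j (g j) (linesAfter g N j))).congr_deriv ?_
  rw [mul_smul_comm, smul_mul_assoc, neg_one_mul]

/-- The second-order consequence of the exchange identity. -/
theorem IsTemperleyLieb.sum_conj_deriv_leftSum (h : IsTemperleyLieb q n e) (hq : q ≠ 0)
    (hS : IsRegularSet q S) (hg : ∀ i, g i ∈ S)
    (hloop : ∀ᶠ s in 𝓝 (0 : ℂ), ∑ j ∈ Finset.range N, leftLoop q e g N j (Complex.exp s * g j) =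
      ∑ j ∈ Finset.range N, rightLoop q e g N j (g j / Complex.exp s)) {m' : ℕ → A}
    (hm : ∀ j ∈ Finset.range N, HasDerivAt (fun s => leftSum q e 0 (Complex.exp s * g j)
      (linesBefore g j ++ linesAfter g N j)) (m' j) 0) :
    ∑ j ∈ Finset.range N, moveLeft q e j (g j) (linesAfter g N j) * m' j *
      moveRight q e j (g j) (linesAfter g N j) = 0 := by
  have hκ : -(q - q⁻¹) ≠ 0 := neg_ne_zero.2 (hS.sub_inv_ne_zero (hg 0))
  have hm_neg : ∀ j ∈ Finset.range N, HasDerivAt (fun s => leftSum q e 0 (g j / Complex.exp s)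
      (linesBefore g j ++ linesAfter g N j)) (-m' j) 0 := fun j hj => by
    have := HasDerivAt.scomp (0 : ℂ) (by simpa using hm j hj) (hasDerivAt_neg (0 : ℂ))
    simp only [Function.comp_def, Complex.exp_neg, neg_one_smul] at this
    simpa only [div_eq_inv_mul] using this
  have hregL : ∀ᶠ s in 𝓝 (0 : ℂ), ∀ j ∈ Finset.range N,
      IsRegularSet q (insert (Complex.exp s * g j) S) :=
    (Filter.eventually_all_finset _).2 fun j _ => hS.eventually_insert_exp_mul (hg j)
  have hregR : ∀ᶠ s in 𝓝 (0 : ℂ), ∀ j ∈ Finset.range N,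
      IsRegularSet q (insert (g j / Complex.exp s) S) :=
    (Filter.eventually_all_finset _).2 fun j _ => hS.eventually_insert
      (hasDerivAt_div_exp (g j) 0).continuousAt (by simpa using hg j)
  have hfirst : (fun s => ∑ j ∈ Finset.range N, moveLeft q e j (g j) (linesAfter g N j) *
        (leftSum q e 0 (Complex.exp s * g j) (linesBefore g j ++ linesAfter g N j) *
        moveRight q e 0 (Complex.exp s * g j) (linesBefore g j ++ linesAfter g N j)) *
          moveLeft q e 0 (g j) (linesBefore g j)) =ᶠ[𝓝 0]
      fun s => ∑ j ∈ Finset.range N, moveRight q e 0 (g j) (linesBefore g j) *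
        (moveLeft q e 0 (g j / Complex.exp s) (linesBefore g j ++ linesAfter g N j) *
        leftSum q e 0 (g j / Complex.exp s) (linesBefore g j ++ linesAfter g N j)) *
          moveRight q e j (g j) (linesAfter g N j) := by
    filter_upwards [hloop.eventually_nhds, hregL, hregR] with s hs hL hR
    have hd := (HasDerivAt.fun_sum fun j hj => h.hasDerivAt_leftLoop (N := N) hq hg (hL j hj)).unique
      ((HasDerivAt.fun_sum fun j hj =>
        h.hasDerivAt_rightLoop (N := N) hq hS hg (hR j hj)).congr_of_eventuallyEq hs)
    rw [← Finset.smul_sum, ← Finset.smul_sum] at hd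
    exact smul_right_injective A hκ hd
  have hmem := mem_linesBefore_append hg N
  have hsecond := (HasDerivAt.fun_sum fun j (hj : j ∈ Finset.range N) =>
    (((hm j hj).fun_mul (h.hasDerivAt_moveRight hq hS (hasDerivAt_exp_mul (g j) 0)
      (by simpa using hg j) (hmem j) 0)).const_mul
        (moveLeft q e j (g j) (linesAfter g N j))).mul_const
          (moveLeft q e 0 (g j) (linesBefore g j))).unique
    ((HasDerivAt.fun_sum fun j (hj : j ∈ Finset.range N) =>
      (((h.hasDerivAt_moveLeft hq hS (hasDerivAt_div_exp (g j) 0) (by simpa using hg j)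
        (fun s => div_ne_zero (hS.ne_zero _ (hg j)) (Complex.exp_ne_zero s)) (hmem j) 0).fun_mul
          (hm_neg j hj)).const_mul (moveRight q e 0 (g j) (linesBefore g j))).mul_const
            (moveRight q e j (g j) (linesAfter g N j))).congr_of_eventuallyEq hfirst)
  have hright : ∀ j, moveRight q e 0 (g j) (linesBefore g j ++ linesAfter g N j) *
      moveLeft q e 0 (g j) (linesBefore g j) = moveRight q e j (g j) (linesAfter g N j) :=
    fun j => by
    rw [moveRight_append, mul_assoc, h.moveRight_mul_moveLeft hq hS (hg j) (mem_linesBefore hg j),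
      mul_one, length_linesBefore, Nat.zero_add]
  have hleft : ∀ j, moveRight q e 0 (g j) (linesBefore g j) *
      moveLeft q e 0 (g j) (linesBefore g j ++ linesAfter g N j) =
        moveLeft q e j (g j) (linesAfter g N j) := fun j => by
    rw [moveLeft_append, ← mul_assoc, h.moveRight_mul_moveLeft hq hS (hg j) (mem_linesBefore hg j),
      one_mul, length_linesBefore, Nat.zero_add]
  simp only [Complex.exp_zero, one_mul, div_one, neg_one_mul] at hsecond
  rw [← sub_eq_zero, ← Finset.sum_sub_distrib] at hsecond
  have htwo : (2 : ℂ) • ∑ j ∈ Finset.range N, moveLeft q e j (g j) (linesAfter g N j) * m' j *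
      moveRight q e j (g j) (linesAfter g N j) = 0 := by
    rw [← hsecond, Finset.smul_sum]
    refine Finset.sum_congr rfl fun j _ => ?_
    simp only [mul_add, add_mul, mul_neg, neg_mul, neg_smul, mul_smul_comm, smul_mul_assoc]
    simp only [mul_assoc, hright]
    simp only [← mul_assoc, hleft]
    module
  exact (smul_eq_zero.1 htwo).resolve_left two_ne_zero

end Loops

theorem sum_deriv_single_eq_zero {N : ℕ} {F : (Fin N → ℂ) → A} (hF : DifferentiableAt ℂ F 0)
    (hdiag : ∀ t : ℂ, F (fun _ => t) = F 0) {F' : Fin N → A}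
    (hF' : ∀ j, HasDerivAt (fun t => F (Pi.single j t)) (F' j) 0) : ∑ j, F' j = 0 := by
  have hline : ∀ v : Fin N → ℂ, HasDerivAt (fun t : ℂ => F (t • v)) (fderiv ℂ F 0 v) 0 :=
      fun v => by
    have h1 : HasDerivAt (fun t : ℂ => t • v) v 0 := by
      simpa using (hasDerivAt_id (0 : ℂ)).smul_const v
    exact HasFDerivAt.comp_hasDerivAt (0 : ℂ) (by simpa using hF.hasFDerivAt) h1
  have hsingle : ∀ j, F' j = fderiv ℂ F 0 (Pi.single j 1) := fun j => by
    refine (hF' j).unique ((hline (Pi.single j 1)).congr_of_eventuallyEq (.of_forall fun t => ?_))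
    simp only [← Pi.single_smul, smul_eq_mul, mul_one]
  have hone : fderiv ℂ F 0 (fun _ => 1) = 0 := by
    refine (hline _).unique ((hasDerivAt_const 0 (F 0)).congr_of_eventuallyEq
      (.of_forall fun t => ?_))
    exact (congrArg F (by ext; simp)).trans (hdiag t)
  simp only [hsingle, ← map_sum]
  rw [Finset.univ_sum_single fun _ => (1 : ℂ), hone]

theorem IsTemperleyLieb.commute_totalLeft_rightSum (h : IsTemperleyLieb q n e) (hq : q ≠ 0)
    {N : ℕ} {ζ : ℂ} {g : ℕ → ℂ} (hqN : q ^ N - q⁻¹ ^ N ≠ 0) (hS : IsRegularSet q S)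
    (hNn : N ≤ n + 1) (hζ : IsPrimitiveRoot ζ N) (hg : ∀ i, g i = ζ ^ (i + 1))
    (hgS : ∀ i, g i ∈ S) :
    Commute (totalLeft q e [] ((List.range' 0 N).map g))
      (∑ j ∈ Finset.range N, rightSum q e j (g j) (linesAfter g N j)) := by
  rcases Nat.eq_zero_or_pos N with rfl | hN
  · simp
  have : NeZero N := ⟨hN.ne'⟩
  have hg0 : ∀ i, g i ≠ 0 := fun i => hS.ne_zero _ (hgS i)
  have hloop : ∀ᶠ s in 𝓝 (0 : ℂ),
      ∑ j ∈ Finset.range N, leftLoop q e g N j (Complex.exp s * g j) =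
        ∑ j ∈ Finset.range N, rightLoop q e g N j (g j / Complex.exp s) := by
    have : ∀ᶠ s in 𝓝 (0 : ℂ), (q * Complex.exp s) ^ N - q⁻¹ ^ N ≠ 0 :=
      ContinuousAt.eventually_ne (by fun_prop) (by simpa using hqN)
    filter_upwards [this] with s hs
    exact h.sum_leftLoop_eq_sum_rightLoop hq hqN hS hNn hζ hg hgS hs
  have hm : ∀ j, HasDerivAt (fun s => leftSum q e 0 (Complex.exp s * g j)
      (linesBefore g j ++ linesAfter g N j)) (deriv (fun s => leftSum q e 0 (Complex.exp s * g j)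
      (linesBefore g j ++ linesAfter g N j)) 0) 0 := fun j => by
    refine DifferentiableAt.hasDerivAt ?_
    have := differentiableAt_leftSum (e := e) hS (hasDerivAt_exp_mul (g j) 0).differentiableAt
      (by simpa using hgS j) (fun s => mul_ne_zero (Complex.exp_ne_zero s) (hg0 j))
      (G := fun i _ => g i) (fun i => differentiableAt_const _) hgS (fun i _ => hg0 i)
      (List.range' 0 j ++ List.range' (j + 1) (N - 1 - j)) 0
    simpa only [List.map_append, linesBefore, linesAfter] using this
  have hzero := h.sum_conj_deriv_leftSum hq hS hgS hloop fun j _ => hm j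
  have hF := differentiableAt_totalLeft (e := e) (E := Fin N → ℂ) (x := 0) hS
    (G := fun i s => Complex.exp (s (Fin.ofNat N i)) * g i) (fun i => by fun_prop)
    (fun i => by simpa using hgS i)
    (fun i s => mul_ne_zero (Complex.exp_ne_zero _) (hg0 i)) [] (List.range' 0 N)
  have hsum := sum_deriv_single_eq_zero hF (fun t => by
    have := totalLeft_smul (q := q) (e := e) (Complex.exp_ne_zero t) [] ((List.range' 0 N).map g)
    simpa [Function.comp_def, mul_comm] using this) fun j => by
      have hj := j.2
      refine (h.hasDerivAt_totalLeft_line hq hS (hgS j) (mem_linesBefore hgS j)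
        (mem_linesAfter hgS N j) (by rw [length_linesBefore, length_linesAfter]; omega)
          (hm j)).congr_of_eventuallyEq (.of_forall fun t => ?_)
      have hne : ∀ i < N, i ≠ j → Fin.ofNat N i ≠ j := fun i hi hij heq => hij <| by
        rw [← heq, Fin.val_ofNat, Nat.mod_eq_of_lt hi]
      simp only [List.map_nil]
      rw [range'_split (i := j) (Nat.zero_le _) (by omega), List.map_append, List.map_cons,
        Fin.ofNat_val_eq_self, Pi.single_eq_same, linesBefore, linesAfter, Nat.zero_add,
        Nat.sub_zero]
      congr 2
      · refine List.map_congr_left fun i hi => ?_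
        rw [List.mem_range'_1] at hi
        rw [Pi.single_eq_of_ne (hne i (by omega) (by omega)), Complex.exp_zero, one_mul]
      · congr 1
        refine List.map_congr_left fun i hi => ?_
        rw [List.mem_range'_1] at hi
        rw [Pi.single_eq_of_ne (hne i (by omega) (by omega)), Complex.exp_zero, one_mul]
  rw [Fin.sum_univ_eq_sum_range fun j => (q - q⁻¹) • (rightSum q e (linesBefore g j).length (g j)
      (linesAfter g N j) * totalLeft q e [] (linesBefore g j ++ g j :: linesAfter g N j) -
        totalLeft q e [] (linesBefore g j ++ g j :: linesAfter g N j) *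
          rightSum q e (linesBefore g j).length (g j) (linesAfter g N j)) +
      moveLeft q e (linesBefore g j).length (g j) (linesAfter g N j) *
        deriv (fun s => leftSum q e 0 (Complex.exp s * g j)
          (linesBefore g j ++ linesAfter g N j)) 0 *
        moveRight q e (linesBefore g j).length (g j) (linesAfter g N j),
    Finset.sum_add_distrib] at hsum
  simp only [length_linesBefore] at hsum
  rw [hzero, add_zero, ← Finset.smul_sum] at hsum
  have hcomm := (smul_eq_zero.1 hsum).resolve_left (hS.sub_inv_ne_zero (hgS 0))
  have hlist : ∀ j ∈ Finset.range N, linesBefore g j ++ g j :: linesAfter g N j =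
      (List.range' 0 N).map g := fun j hj => by
    rw [range'_split (i := j) (Nat.zero_le _) (by simpa using hj), List.map_append, List.map_cons,
      linesBefore, linesAfter, Nat.zero_add, Nat.sub_zero]
  rw [Finset.sum_congr rfl fun j hj => by rw [hlist j hj], Finset.sum_sub_distrib,
    ← Finset.sum_mul, ← Finset.mul_sum, sub_eq_zero] at hcomm
  exact hcomm.symm

theorem commute_smul_smul {x y : A} (h : Commute x y) (c d : ℂ) : Commute (c • x) (d • y) :=
  (h.smul_left c).smul_right d

end Calculus

/-! ### The spin chain -/

section SpinChain

variable {N : ℕ}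

/-- A two-site operator as a continuous linear map. -/
def twoSiteCLM [NeZero N] (M : Bool → Bool → Bool → Bool → ℂ) (a b : ZMod N) :
    Chain N →L[ℂ] Chain N where
  toFun := twoSiteOp M a b
  map_add' ψ φ := by
    ext x
    simp only [twoSiteOp, Pi.add_apply, mul_add, Finset.sum_add_distrib]
  map_smul' c ψ := by
    ext x
    simp only [twoSiteOp, Pi.smul_apply, smul_eq_mul, Finset.mul_sum, RingHom.id_apply,
      mul_left_comm c]
  cont := by
    unfold twoSiteOp
    fun_prop

/-- The generator `e_{k+1}`, extended by zero beyond the end of the chain. -/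
def chainGen (N : ℕ) [NeZero N] (q : ℂ) (k : ℕ) : Chain N →L[ℂ] Chain N :=
  if k + 1 < N then twoSiteCLM (eE q) ((k + 1 : ℕ) : ZMod N) ((k + 1 + 1 : ℕ) : ZMod N) else 0

theorem natCast_ne_natCast {i j : ℕ} (hij : i < j) (hj : j < i + N) :
    (i : ZMod N) ≠ (j : ZMod N) := by
  rw [Ne, ZMod.natCast_eq_natCast_iff, Nat.modEq_iff_dvd' hij.le]
  exact fun h => absurd (Nat.le_of_dvd (by omega) h) (by omega)

/-- The configuration `x` modified at three sites. -/
def update₃ (a b c : ZMod N) (x : ZMod N → Bool) (r s t : Bool) : ZMod N → Bool :=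
  Function.update (Function.update (Function.update x a r) b s) c t

theorem update₃_self (a b c : ZMod N) (x : ZMod N → Bool) :
    update₃ a b c x (x a) (x b) (x c) = x := by
  simp [update₃]

section Update

variable {a b c : ZMod N} (M : Bool → Bool → Bool → Bool → ℂ) (ψ : Chain N) (x : ZMod N → Bool)

theorem twoSiteOp_update₃_left (hab : a ≠ b) (hac : a ≠ c) (hbc : b ≠ c) (r s t : Bool) :
    twoSiteOp M a b ψ (update₃ a b c x r s t) =
      ∑ p : Bool × Bool, M r s p.1 p.2 * ψ (update₃ a b c x p.1 p.2 t) := by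
  refine Finset.sum_congr rfl fun p _ => ?_
  refine congrArg₂ (· * ·) (by simp [update₃, hab, hac, hbc]) (congrArg ψ (funext fun i => ?_))
  simp only [update₃, Function.update_apply]
  grind

theorem twoSiteOp_update₃_right (hbc : b ≠ c) (r s t : Bool) :
    twoSiteOp M b c ψ (update₃ a b c x r s t) =
      ∑ p : Bool × Bool, M s t p.1 p.2 * ψ (update₃ a b c x r p.1 p.2) := by
  refine Finset.sum_congr rfl fun p _ => ?_
  refine congrArg₂ (· * ·) (by simp [update₃, hbc]) (congrArg ψ (funext fun i => ?_))
  simp only [update₃, Function.update_apply]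
  grind

end Update

theorem twoSiteOp_eE_sq {q : ℂ} (hq : q ≠ 0) {a b : ZMod N} (hab : a ≠ b) (ψ : Chain N) :
    twoSiteOp (eE q) a b (twoSiteOp (eE q) a b ψ) = (q + q⁻¹) • twoSiteOp (eE q) a b ψ := by
  ext x
  simp only [twoSiteOp, Pi.smul_apply, smul_eq_mul, Fintype.sum_prod_type, Fintype.sum_bool,
    Function.update_self, Function.update_of_ne hab, Function.update_idem,
    Function.update_comm hab.symm]
  cases x a <;> cases x b <;> simp [eE] <;> field_simp <;> ring

theorem twoSiteOp_eE_up {q : ℂ} (hq : q ≠ 0) {a b c : ZMod N} (hab : a ≠ b) (hac : a ≠ c)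
    (hbc : b ≠ c) (ψ : Chain N) : twoSiteOp (eE q) a b (twoSiteOp (eE q) b c (twoSiteOp (eE q) a b ψ)) =
      twoSiteOp (eE q) a b ψ := by
  ext x
  rw [← update₃_self a b c x]
  simp only [twoSiteOp_update₃_left _ _ _ hab hac hbc, twoSiteOp_update₃_right _ _ _ hbc,
    Fintype.sum_prod_type, Fintype.sum_bool]
  cases x a <;> cases x b <;> cases x c <;> simp [eE, hq] <;> field_simp <;> ring

theorem twoSiteOp_eE_down {q : ℂ} (hq : q ≠ 0) {a b c : ZMod N} (hab : a ≠ b) (hac : a ≠ c)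
    (hbc : b ≠ c) (ψ : Chain N) : twoSiteOp (eE q) b c (twoSiteOp (eE q) a b (twoSiteOp (eE q) b c ψ)) =
      twoSiteOp (eE q) b c ψ := by
  ext x
  rw [← update₃_self a b c x]
  simp only [twoSiteOp_update₃_left _ _ _ hab hac hbc, twoSiteOp_update₃_right _ _ _ hbc,
    Fintype.sum_prod_type, Fintype.sum_bool]
  cases x a <;> cases x b <;> cases x c <;> simp [eE, hq] <;> field_simp <;> ring

theorem twoSiteOp_comm {a b c d : ZMod N} (hac : a ≠ c) (had : a ≠ d) (hbc : b ≠ c) (hbd : b ≠ d)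
    (M M' : Bool → Bool → Bool → Bool → ℂ) (ψ : Chain N) :
    twoSiteOp M a b (twoSiteOp M' c d ψ) = twoSiteOp M' c d (twoSiteOp M a b ψ) := by
  ext x
  simp only [twoSiteOp, Finset.mul_sum]
  rw [Finset.sum_comm]
  refine Finset.sum_congr rfl fun s _ => Finset.sum_congr rfl fun t _ => ?_
  rw [mul_left_comm]
  refine congrArg₂ (· * ·) (by simp [hac.symm, hbc.symm, had.symm, hbd.symm])
    (congrArg₂ (· * ·) (by simp [hac, hbc, had, hbd]) (congrArg ψ (funext fun i => ?_)))
  simp only [Function.update_apply]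
  grind

theorem isTemperleyLieb_chainGen [NeZero N] {q : ℂ} (hq : q ≠ 0) :
    IsTemperleyLieb q (N - 1) (chainGen N q) where
  sq k := by
    unfold chainGen
    split_ifs with hk
    · exact ContinuousLinearMap.ext (twoSiteOp_eE_sq hq (natCast_ne_natCast (by omega) (by omega)))
    · simp
  up k hk := by
    unfold chainGen
    rw [if_pos (by omega), if_pos (by omega)]
    exact ContinuousLinearMap.ext (twoSiteOp_eE_up hq (natCast_ne_natCast (by omega) (by omega))
      (natCast_ne_natCast (by omega) (by omega)) (natCast_ne_natCast (by omega) (by omega)))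
  down k hk := by
    unfold chainGen
    rw [if_pos (by omega), if_pos (by omega)]
    exact ContinuousLinearMap.ext (twoSiteOp_eE_down hq (natCast_ne_natCast (by omega) (by omega))
      (natCast_ne_natCast (by omega) (by omega)) (natCast_ne_natCast (by omega) (by omega)))
  comm k l hkl := by
    unfold chainGen
    split_ifs with hk hl
    · exact ContinuousLinearMap.ext (twoSiteOp_comm (natCast_ne_natCast (by omega) (by omega))
        (natCast_ne_natCast (by omega) (by omega)) (natCast_ne_natCast (by omega) (by omega))
          (natCast_ne_natCast (by omega) (by omega)) _ _)
    · exact Commute.zero_right _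
    · exact Commute.zero_left _
    · exact Commute.zero_left _

theorem RE_eq {q u : ℂ} (hu : q * u - q⁻¹ ≠ 0) (r s t v : Bool) :
    RE q u r s t v = (if r = t ∧ s = v then 1 else 0) - fR q u * eE q r s t v := by
  have hf : u * gR q u = 1 - fR q u * q⁻¹ := by
    unfold fR gR
    rw [div_mul_eq_mul_div, mul_div_assoc', div_eq_iff hu, sub_mul, div_mul_cancel₀ _ hu]
    ring
  have hg : gR q u = 1 - fR q u * q := by
    unfold fR gR
    rw [div_mul_eq_mul_div, div_eq_iff hu, sub_mul, div_mul_cancel₀ _ hu]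
    ring
  cases r <;> cases s <;> cases t <;> cases v <;> simp [RE, eE, hf]
  exact hg

theorem coe_bax_chainGen [NeZero N] {q u : ℂ} (hu : q * u - q⁻¹ ≠ 0) {k : ℕ} (hk : k + 1 < N) :
    ⇑(bax q (chainGen N q) k u) = Rop N q u (k + 1) := by
  ext ψ x
  change ψ x - (fR q u • chainGen N q k ψ) x = _
  rw [chainGen, if_pos hk]
  change ψ x - fR q u * twoSiteOp _ _ _ ψ x = twoSiteOp _ _ _ ψ x
  simp only [twoSiteOp, RE_eq hu, sub_mul, Finset.sum_sub_distrib, Finset.mul_sum, mul_assoc]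
  congr 1
  rw [Finset.sum_eq_single (x ((k + 1 : ℕ) : ZMod N), x ((k + 1 + 1 : ℕ) : ZMod N))]
  · simp
  · rintro ⟨r, s⟩ - hne
    rw [if_neg (fun hrs => hne (Prod.ext hrs.1.symm hrs.2.symm)), zero_mul]
  · simp

/-! ### Closed forms of the interactions -/

theorem moveRight_map_range' {A : Type*} [Ring A] [Algebra ℂ A] (q : ℂ) (e : ℕ → A) (w : ℂ)
    (G : ℕ → ℂ) (a n : ℕ) : moveRight q e a w ((List.range' a n).map G) =
      ((List.range' a n).reverse.map fun m => bax q e m (w / G m)).prod := by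
  induction n generalizing a with
  | zero => rfl
  | succ n ih => simp [List.range'_succ, moveRight, ih]

theorem moveLeft_map_range' {A : Type*} [Ring A] [Algebra ℂ A] (q : ℂ) (e : ℕ → A) (w : ℂ)
    (G : ℕ → ℂ) (a n : ℕ) : moveLeft q e a w ((List.range' a n).map G) =
      ((List.range' a n).map fun m => bax q e m (G m / w)).prod := by
  induction n generalizing a with
  | zero => rfl
  | succ n ih => simp [List.range'_succ, moveLeft, ih]

theorem leftSum_map_range' {A : Type*} [Ring A] [Algebra ℂ A] (q : ℂ) (e : ℕ → A) (w : ℂ)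
    (G : ℕ → ℂ) (a n : ℕ) : leftSum q e a w ((List.range' a n).map G) =
      ∑ i ∈ Finset.Ico a (a + n), pot q (G i) w •
        (moveRight q e (i + 1) w ((List.range' (i + 1) (a + n - 1 - i)).map G) * e i *
          moveLeft q e (i + 1) w ((List.range' (i + 1) (a + n - 1 - i)).map G)) := by
  induction n generalizing a with
  | zero => simp [leftSum]
  | succ n ih =>
    rw [Finset.sum_eq_sum_Ico_succ_bot (by omega), List.range'_succ, List.map_cons, leftSum, ih,
      show a + (n + 1) - 1 - a = n by omega, show a + (n + 1) = a + 1 + n by omega]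

theorem rightSum_map_range' {A : Type*} [Ring A] [Algebra ℂ A] (q : ℂ) (e : ℕ → A) (w : ℂ)
    (G : ℕ → ℂ) (a n : ℕ) : rightSum q e a w ((List.range' a n).map G) =
      ∑ i ∈ Finset.Ico a (a + n), pot q w (G i) •
        (moveLeft q e a w ((List.range' a (i - a)).map G) * e i *
          moveRight q e a w ((List.range' a (i - a)).map G)) := by
  induction n generalizing a with
  | zero => simp [rightSum]
  | succ n ih =>
    rw [Finset.sum_eq_sum_Ico_succ_bot (by omega), List.range'_succ, List.map_cons, rightSum, ih,
      show a + (n + 1) = a + 1 + n by omega, Finset.mul_sum, Finset.sum_mul, Nat.sub_self]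
    refine congrArg₂ (· + ·) (by simp [moveLeft, moveRight]) (Finset.sum_congr rfl fun i hi => ?_)
    rw [Finset.mem_Ico] at hi
    rw [show i - a = (i - (a + 1)) + 1 by omega, List.range'_succ, List.map_cons, moveLeft,
      moveRight, mul_smul_comm, smul_mul_assoc]
    simp only [mul_assoc]

theorem totalLeft_map_range' {A : Type*} [Ring A] [Algebra ℂ A] (q : ℂ) (e : ℕ → A) (g : ℕ → ℂ)
    (N : ℕ) : totalLeft q e [] ((List.range' 0 N).map g) =
      ∑ j ∈ Finset.range N, leftSum q e 0 (g j) (linesBefore g j) := by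
  have : ∀ b n, totalLeft q e (linesBefore g b) ((List.range' b n).map g) =
      ∑ j ∈ Finset.Ico b (b + n), leftSum q e 0 (g j) (linesBefore g j) := fun b n => by
    induction n generalizing b with
    | zero => simp [totalLeft]
    | succ n ih =>
      rw [Finset.sum_eq_sum_Ico_succ_bot (by omega), List.range'_succ, List.map_cons, totalLeft,
        show linesBefore g b ++ [g b] = linesBefore g (b + 1) by
          simp [linesBefore, List.range'_concat], ih, show b + (n + 1) = b + 1 + n by omega]
  simpa [linesBefore] using this 0 N

theorem coe_prod_eq_compList [NeZero N] {ι : Type*} (l : List ι) (T : ι → Chain N →L[ℂ] Chain N) :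
    ⇑(l.map T).prod = compList (l.map fun i => ⇑(T i)) := by
  induction l with
  | nil => rfl
  | cons i l ih => exact congrArg (⇑(T i) ∘ ·) ih

theorem coe_mul_mul [NeZero N] (S T U : Chain N →L[ℂ] Chain N) :
    ⇑(S * T * U) = ⇑S ∘ ⇑T ∘ ⇑U := rfl

/-- The coordinates `z_{i+1}`. -/
def coord (N i : ℕ) : ℂ := z N (i + 1)

theorem coord_pow (hN : N ≠ 0) (i : ℕ) : coord N i ^ N = 1 := by
  rw [coord, z, ← pow_mul, mul_comm, pow_mul, omega, (Complex.isPrimitiveRoot_exp N hN).pow_eq_one,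
    one_pow]

theorem isRegularSet_roots (hN : 0 < N) {q : ℂ} (hq0 : q ≠ 0) (hq : q ^ (2 * N) ≠ 1) :
    IsRegularSet q {x : ℂ | x ^ N = 1} where
  finite := by
    refine (Polynomial.nthRootsFinset N (1 : ℂ)).finite_toSet.subset fun x hx => ?_
    simpa [Polynomial.mem_nthRootsFinset hN] using hx
  ne_zero := by
    rintro x hx rfl
    simp [hN.ne'] at hx
  no_pole x hx y hy hxy := by
    refine hq ?_
    have h1 : q ^ 2 * x = y := by
      rw [sub_eq_zero] at hxy
      rw [pow_two, mul_assoc, hxy, mul_inv_cancel_left₀ hq0]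
    have h2 := congrArg (· ^ N) h1
    simp only [Set.mem_ofPred_eq] at hx hy
    simpa only [mul_pow, hx, hy, mul_one, ← pow_mul] using h2

section Identification

variable [NeZero N] {q : ℂ} 
theorem coe_bax_coord (hq0 : q ≠ 0) (hq : q ^ (2 * N) ≠ 1) {i j k : ℕ} (hk : k + 1 < N) :
    ⇑(bax q (chainGen N q) k (coord N i / coord N j)) =
      Rop N q (z N (i + 1) / z N (j + 1)) (k + 1) := by
  have hN := NeZero.ne N
  have hS := isRegularSet_roots (Nat.pos_of_ne_zero hN) hq0 hq
  refine coe_bax_chainGen ?_ hk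
  have hj := hS.ne_zero _ (coord_pow hN j)
  have := hS.no_pole _ (coord_pow hN i) _ (coord_pow hN j)
  contrapose! this
  field_simp at this ⊢
  linear_combination this

theorem range'_succ_eq_map (a n : ℕ) :
    List.range' (a + 1) n = (List.range' a n).map fun k => k + 1 := by
  rw [add_comm a, ← List.map_add_range']
  exact List.map_congr_left fun k _ => add_comm 1 k

theorem coe_chainGen {k : ℕ} (hk : k + 1 < N) : ⇑(chainGen N q k) = eop N q (k + 1) := by
  rw [chainGen, if_pos hk]
  rfl

theorem coe_eq_SL (hq0 : q ≠ 0) (hq : q ^ (2 * N) ≠ 1) {i j : ℕ} (hij : i < j) (hj : j < N) :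
    ⇑(moveRight q (chainGen N q) (i + 1) (coord N j)
        ((List.range' (i + 1) (j - 1 - i)).map (coord N)) * chainGen N q i *
      moveLeft q (chainGen N q) (i + 1) (coord N j)
        ((List.range' (i + 1) (j - 1 - i)).map (coord N))) = SL N q (i + 1) (j + 1) := by
  rw [moveRight_map_range', moveLeft_map_range', SL, range'_succ_eq_map (i + 1),
    show j + 1 - 1 - (i + 1) = j - 1 - i by omega, ← coe_chainGen (by omega), ← List.map_reverse,
    List.map_map, List.map_map, coe_mul_mul,
    coe_prod_eq_compList, coe_prod_eq_compList]
  congr 2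
  · refine List.map_congr_left fun k hk => coe_bax_coord hq0 hq ?_
    rw [List.mem_reverse, List.mem_range'_1] at hk
    omega
  · congr 1
    refine List.map_congr_left fun k hk => coe_bax_coord hq0 hq ?_
    rw [List.mem_range'_1] at hk
    omega

theorem coe_eq_SR (hq0 : q ≠ 0) (hq : q ^ (2 * N) ≠ 1) {i m : ℕ} (him : i ≤ m) (hm : m + 1 < N) :
    ⇑(moveLeft q (chainGen N q) i (coord N i)
        ((List.range' i (m - i)).map fun k => coord N (k + 1)) * chainGen N q m *
      moveRight q (chainGen N q) i (coord N i)
        ((List.range' i (m - i)).map fun k => coord N (k + 1))) = SR N q (i + 1) (m + 1 + 1) := by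
  rw [moveRight_map_range', moveLeft_map_range', SR, range'_succ_eq_map,
    show m + 1 + 1 - 1 - (i + 1) = m - i by omega, Nat.add_sub_cancel, ← coe_chainGen hm,
    ← List.map_reverse, List.map_map, List.map_map, coe_mul_mul,
    coe_prod_eq_compList, coe_prod_eq_compList]
  congr 2
  · refine List.map_congr_left fun k hk => coe_bax_coord hq0 hq ?_
    rw [List.mem_range'_1] at hk
    omega
  · congr 1
    refine List.map_congr_left fun k hk => coe_bax_coord hq0 hq ?_
    rw [List.mem_reverse, List.mem_range'_1] at hk
    omega

theorem sum_Icc_sum_Ico_eq {M : Type*} [AddCommMonoid M] (N : ℕ) (f : ℕ → ℕ → M) :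
    ∑ j ∈ Finset.Icc 1 N, ∑ i ∈ Finset.Ico 1 j, f i j =
      ∑ j ∈ Finset.Ico 0 N, ∑ i ∈ Finset.Ico 0 j, f (i + 1) (j + 1) := by
  rw [← Finset.Ico_add_one_right_eq_Icc, ← zero_add 1, ← Finset.sum_Ico_add', zero_add]
  refine Finset.sum_congr rfl fun j _ => ?_
  rw [Finset.sum_Ico_add' (fun i => f i (j + 1)) 0 j 1]

theorem HL_eq_coe (hq0 : q ≠ 0) (hq : q ^ (2 * N) ≠ 1) :
    HL N q = ⇑((qint q N / (N : ℂ)) •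
      totalLeft q (chainGen N q) [] ((List.range' 0 N).map (coord N))) := by
  rw [FunLike.coe_smul, HL, totalLeft_map_range', FunLike.coe_sum, sum_Icc_sum_Ico_eq,
    Finset.range_eq_Ico]
  refine congrArg _ (Finset.sum_congr rfl fun j hj => ?_)
  rw [linesBefore, leftSum_map_range', FunLike.coe_sum, Nat.zero_add]
  refine Finset.sum_congr rfl fun i hi => ?_
  rw [Finset.mem_Ico] at hi hj
  rw [FunLike.coe_smul, coe_eq_SL hq0 hq hi.2 hj.2]
  rfl

theorem HR_eq_coe (hq0 : q ≠ 0) (hq : q ^ (2 * N) ≠ 1) :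
    HR N q = ⇑((qint q N / (N : ℂ)) • ∑ j ∈ Finset.range N,
      rightSum q (chainGen N q) j (coord N j) (linesAfter (coord N) N j)) := by
  rw [FunLike.coe_smul, HR, FunLike.coe_sum, sum_Icc_sum_Ico_eq, Finset.range_eq_Ico,
    ← Finset.sum_Ico_Ico_comm']
  refine congrArg _ (Finset.sum_congr rfl fun i hi => ?_)
  rw [Finset.mem_Ico] at hi
  rw [linesAfter, range'_succ_eq_map, List.map_map, Function.comp_def, rightSum_map_range',
    FunLike.coe_sum, show Finset.Ico (i + 1) N = Finset.Ico (i + 1) (i + (N - 1 - i) + 1) by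
      congr 1; omega, ← Finset.sum_Ico_add']
  refine Finset.sum_congr rfl fun m hm => ?_
  rw [Finset.mem_Ico] at hm
  rw [FunLike.coe_smul, coe_eq_SR hq0 hq hm.1 (by omega)]
  rfl

end Identification

end SpinChain

/-- The left and right q-deformed Haldane–Shastry Hamiltonians commute:
`H^L ∘ H^R = H^R ∘ H^L` as endomorphisms of `H = (ℂ²)^{⊗N}`. -/
theorem HL_comp_HR_eq_HR_comp_HL (N : ℕ) (hN : 0 < N) (q : ℂ) (hq0 : q ≠ 0)
    (hq : q ^ (2 * N) ≠ 1) :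
    HL N q ∘ HR N q = HR N q ∘ HL N q := by
  have : NeZero N := ⟨hN.ne'⟩
  have hqN : q ^ N - q⁻¹ ^ N ≠ 0 := by
    contrapose! hq
    rw [sub_eq_zero] at hq
    rw [two_mul, pow_add]
    nth_rewrite 1 [hq]
    rw [← mul_pow, inv_mul_cancel₀ hq0, one_pow]
  rw [HL_eq_coe hq0 hq, HR_eq_coe hq0 hq]
  have hcomm := (isTemperleyLieb_chainGen (N := N) hq0).commute_totalLeft_rightSum hq0 hqN
    (isRegularSet_roots hN hq0 hq) (N := N) (by omega) (Complex.isPrimitiveRoot_exp N hN.ne')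
    (g := coord N) (fun i => rfl) (coord_pow hN.ne')
  exact congrArg DFunLike.coe (commute_smul_smul hcomm (qint q N / (N : ℂ)) (qint q N / (N : ℂ))).eq

end Stmt0
end
end

section
/- Let G := Ř_{N−1,N}(ω^{−(N−1)}) ∘ Ř_{N−2,N−1}(ω^{−(N−2)}) ∘ ⋯ ∘ Ř_{1,2}(ω^{−1}) ∈ End(H) (the product of the operators Ř_{k,k+1}(ω^{−k}) taken with k decreasing from N−1 to 1). Then G^N = id_H, and G commutes with the Hamiltonian: G ∘ H^L = H^L ∘ G. -/
open scoped BigOperators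

noncomputable section

namespace Stmt1

/-- The primitive `N`-th root of unity `ω = exp(2πi/N)`. -/
def omega (N : ℕ) : ℂ := Complex.exp (2 * (Real.pi : ℂ) * Complex.I / (N : ℂ))

/-- The coordinates `z_j = ω^j`. -/
def z (N : ℕ) (j : ℕ) : ℂ := omega N ^ j

/-- The spin-chain Hilbert space `H = (ℂ²)^{⊗N}`, realised as the space of complex functions on
spin configurations.  The sites `1, …, N` are labelled by `ZMod N` (site `j` is `(j : ZMod N)`),
and `false = ↑`, `true = ↓`. -/
abbrev Chain (N : ℕ) := (ZMod N → Bool) → ℂ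

/-- The operator acting on the tensor factors at the (distinct) sites `a` and `b` by the
two-site matrix with entries `A out_a out_b in_a in_b`, and by the identity elsewhere. -/
def twoSiteOp {N : ℕ} (A : Bool → Bool → Bool → Bool → ℂ) (a b : ZMod N) :
    Chain N → Chain N := fun ψ x =>
  ∑ s : Bool × Bool,
    A (x a) (x b) s.1 s.2 * ψ (Function.update (Function.update x a s.1) b s.2)

def fR (q u : ℂ) : ℂ := (u - 1) / (q * u - q⁻¹)

def gR (q u : ℂ) : ℂ := (q - q⁻¹) / (q * u - q⁻¹)

/-- Matrix entries of the R-matrix `Ř(u)` in the ordered basis `(↑↑, ↑↓, ↓↑, ↓↓)`. -/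
def RE (q u : ℂ) : Bool → Bool → Bool → Bool → ℂ
  | false, false, false, false => 1
  | false, true, false, true => u * gR q u
  | false, true, true, false => fR q u
  | true, false, false, true => fR q u
  | true, false, true, false => gR q u
  | true, true, true, true => 1
  | _, _, _, _ => 0

/-- Matrix entries of the Temperley–Lieb generator `e` in the basis `(↑↑, ↑↓, ↓↑, ↓↓)`. -/
def eE (q : ℂ) : Bool → Bool → Bool → Bool → ℂ
  | false, true, false, true => q⁻¹
  | false, true, true, false => -1
  | true, false, false, true => -1
  | true, false, true, false => q
  | _, _, _, _ => 0

/-- `Ř_{k,k+1}(u)` acting on sites `k, k+1`. -/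
def Rop (N : ℕ) (q u : ℂ) (k : ℕ) : Chain N → Chain N :=
  twoSiteOp (RE q u) ((k : ℕ) : ZMod N) (((k + 1 : ℕ)) : ZMod N)

/-- The Temperley–Lieb generator `e_k` acting on sites `k, k+1`. -/
def eop (N : ℕ) (q : ℂ) (k : ℕ) : Chain N → Chain N :=
  twoSiteOp (eE q) ((k : ℕ) : ZMod N) (((k + 1 : ℕ)) : ZMod N)

/-- Composition of a list of operators (the head of the list acts last). -/
def compList {α : Type*} (l : List (α → α)) : α → α := l.foldr (· ∘ ·) id

/-- The long-range spin interaction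
`S^L_{[i,j]} = Ř_{j−1,j}(z_j/z_{j−1})⋯Ř_{i+1,i+2}(z_j/z_{i+1}) ∘ e_i ∘
Ř_{i+1,i+2}(z_{i+1}/z_j)⋯Ř_{j−1,j}(z_{j−1}/z_j)` (for `1 ≤ i < j ≤ N`). -/
def SL (N : ℕ) (q : ℂ) (i j : ℕ) : Chain N → Chain N :=
  compList (((List.range' (i + 1) (j - 1 - i)).reverse).map fun k => Rop N q (z N j / z N k) k) ∘
    eop N q i ∘
      compList ((List.range' (i + 1) (j - 1 - i)).map fun k => Rop N q (z N k / z N j) k)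

/-- The long-range spin interaction
`S^R_{[i,j]} = Ř_{i,i+1}(z_{i+1}/z_i)⋯Ř_{j−2,j−1}(z_{j−1}/z_i) ∘ e_{j−1} ∘
Ř_{j−2,j−1}(z_i/z_{j−1})⋯Ř_{i,i+1}(z_i/z_{i+1})` (for `1 ≤ i < j ≤ N`). -/
def SR (N : ℕ) (q : ℂ) (i j : ℕ) : Chain N → Chain N :=
  compList ((List.range' i (j - 1 - i)).map fun k => Rop N q (z N (k + 1) / z N i) k) ∘
    eop N q (j - 1) ∘
      compList (((List.range' i (j - 1 - i)).reverse).map fun k => Rop N q (z N i / z N (k + 1)) k)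

/-- The symmetric q-integer `[n]_q = (qⁿ − q⁻ⁿ)/(q − q⁻¹)`. -/
def qint (q : ℂ) (n : ℕ) : ℂ := (q ^ n - q⁻¹ ^ n) / (q - q⁻¹)

/-- The pair potential `V(x, y) = x·y/((q·x − q⁻¹·y)·(q·y − q⁻¹·x))`. -/
def pot (q x y : ℂ) : ℂ := x * y / ((q * x - q⁻¹ * y) * (q * y - q⁻¹ * x))

/-- The left q-deformed Haldane–Shastry Hamiltonian
`H^L = ([N]_q/N)·Σ_{1 ≤ i < j ≤ N} V(z_i, z_j)·S^L_{[i,j]}`. -/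
def HL (N : ℕ) (q : ℂ) : Chain N → Chain N :=
  (qint q N / (N : ℂ)) • ∑ j ∈ Finset.Icc 1 N, ∑ i ∈ Finset.Ico 1 j,
    pot q (z N i) (z N j) • SL N q i j

/-- The right q-deformed Haldane–Shastry Hamiltonian
`H^R = ([N]_q/N)·Σ_{1 ≤ i < j ≤ N} V(z_i, z_j)·S^R_{[i,j]}`. -/
def HR (N : ℕ) (q : ℂ) : Chain N → Chain N :=
  (qint q N / (N : ℂ)) • ∑ j ∈ Finset.Icc 1 N, ∑ i ∈ Finset.Ico 1 j,
    pot q (z N i) (z N j) • SR N q i j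

/-- The q-translation operator
`G = Ř_{N−1,N}(ω^{−(N−1)}) ∘ Ř_{N−2,N−1}(ω^{−(N−2)}) ∘ ⋯ ∘ Ř_{1,2}(ω^{−1})`. -/
def G (N : ℕ) (q : ℂ) : Chain N → Chain N :=
  compList (((List.range' 1 (N - 1)).reverse).map fun k => Rop N q ((omega N)⁻¹ ^ k) k)

theorem braid_of_scalar {A : Type*} [Ring A] [Algebra ℂ A] {d x y w : ℂ} {a b : A} (ha : a * a = d • a) (hb : b * b = d • b)
    (haba : a * b * a = a) (hbab : b * a * b = b) (h : x + w - x * w * d + x * y * w = y) :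
    (1 - x • a) * (1 - y • b) * (1 - w • a) = (1 - w • b) * (1 - y • a) * (1 - x • b) := by
  simp only [sub_mul, mul_sub, one_mul, mul_one, smul_mul_assoc, mul_smul_comm, smul_sub,
    ha, hb, haba, hbab]
  linear_combination (norm := module) (-h) • a + h • b

theorem intertwine_of_scalar {A : Type*} [Ring A] [Algebra ℂ A] {d x v w s s' t t' : ℂ} {a b : A} (ha : a * a = d • a)
    (haba : a * b * a = a) (hbab : b * a * b = b)
    (h₁ : v + w * (s * s') = w + v * (t * t'))
    (h₂ : w - x * w * d + x * w * s = v - x * v * d + x * v * t')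
    (h₃ : w * s + x * v * t * d = v * t + x * (w + v * (t * t')))
    (h₄ : v * t' + x * w * s' * d = w * s' + x * (v + w * (s * s'))) :
    (1 - x • a) * (v • b + w • ((1 - s • b) * a * (1 - s' • b))) =
      (w • b + v • ((1 - t • b) * a * (1 - t' • b))) * (1 - x • a) := by
  have haba' : a * (b * a) = a := by rw [← mul_assoc, haba]
  have haab : a * (a * b) = d • (a * b) := by rw [← mul_assoc, ha, smul_mul_assoc]
  have hbaa : b * a * a = d • (b * a) := by rw [mul_assoc, ha, mul_smul_comm]
  simp only [sub_mul, mul_sub, one_mul, mul_one, smul_mul_assoc, mul_smul_comm, smul_sub,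
    add_mul, mul_add, smul_add, ha, haba, hbab, haba', haab, hbaa]
  linear_combination (norm := module) h₁ • b + h₂ • a - h₃ • (b * a) + h₄ • (a * b)
theorem fR_div {q x y : ℂ} (hq : q ≠ 0) (hy : y ≠ 0) :
    fR q (x / y) = q * (x - y) / (q ^ 2 * x - y) := by
  have : q * (x / y) - q⁻¹ = (q ^ 2 * x - y) / (q * y) := by field_simp
  rw [fR, this]
  rcases eq_or_ne (q ^ 2 * x - y) 0 with h | h
  · simp [h]
  · field_simp

theorem pot_eq {q x y : ℂ} (hq : q ≠ 0) :
    pot q x y = q ^ 2 * x * y / ((q ^ 2 * x - y) * (q ^ 2 * y - x)) := by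
  have h1 : q * x - q⁻¹ * y = (q ^ 2 * x - y) / q := by field_simp
  have h2 : q * y - q⁻¹ * x = (q ^ 2 * y - x) / q := by field_simp
  rw [pot, h1, h2, div_mul_div_comm, div_div_eq_mul_div]
  ring

theorem fR_add_fR_inv {q a b : ℂ} (hq : q ≠ 0) (ha : a ≠ 0) (hb : b ≠ 0)
    (hab : q ^ 2 * a - b ≠ 0) (hba : q ^ 2 * b - a ≠ 0) :
    fR q (a / b) + fR q (b / a) = (q + q⁻¹) * (fR q (a / b) * fR q (b / a)) := by
  have e : q + q⁻¹ = (q ^ 2 + 1) / q := by field_simp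
  rw [fR_div hq hb, fR_div hq ha, e, div_add_div _ _ hab hba]
  field_simp
  ring

theorem fR_braid {q a b c : ℂ} (hq : q ≠ 0) (ha : a ≠ 0) (hb : b ≠ 0)
    (hab : q ^ 2 * a - b ≠ 0) (hca : q ^ 2 * c - a ≠ 0) (hcb : q ^ 2 * c - b ≠ 0) :
    fR q (a / b) + fR q (c / a) - fR q (a / b) * fR q (c / a) * (q + q⁻¹) +
      fR q (a / b) * fR q (c / b) * fR q (c / a) = fR q (c / b) := by
  have e : q + q⁻¹ = (q ^ 2 + 1) / q := by field_simp
  simp only [fR_div hq ha, fR_div hq hb, e]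
  field_simp
  ring

/-- The generators `e 1, …, e (N - 1)` satisfy the Temperley–Lieb relations with loop weight
`q + q⁻¹`. -/
structure IsTemperleyLieb {A : Type*} [Ring A] [Algebra ℂ A] (q : ℂ) (N : ℕ) (e : ℕ → A) :
    Prop where
  sq : ∀ k, 1 ≤ k → k < N → e k * e k = (q + q⁻¹) • e k
  up : ∀ k, 1 ≤ k → k + 1 < N → e k * e (k + 1) * e k = e k
  down : ∀ k, 1 ≤ k → k + 1 < N → e (k + 1) * e k * e (k + 1) = e (k + 1)
  comm : ∀ i j, 1 ≤ i → i + 2 ≤ j → j < N → Commute (e i) (e j)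

section TemperleyLieb

variable {A : Type*} [Ring A] [Algebra ℂ A]

/-- The baxterised generator `1 - f(u) e_k`. -/
def baxter (q : ℂ) (e : ℕ → A) (u : ℂ) (k : ℕ) : A := 1 - fR q u • e k

theorem Commute.baxter_right {q : ℂ} {e : ℕ → A} {x : A} {k : ℕ} (h : Commute x (e k)) (u : ℂ) :
    Commute x (baxter q e u k) :=
  (Commute.one_right x).sub_right (h.smul_right _)

theorem Commute.baxter_left {q : ℂ} {e : ℕ → A} {x : A} {k : ℕ} (h : Commute (e k) x) (u : ℂ) :
    Commute (baxter q e u k) x :=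
  (Commute.baxter_right h.symm u).symm

namespace IsTemperleyLieb

variable {q : ℂ} {N : ℕ} {e : ℕ → A}

theorem baxter_mul_baxter_inv (h : IsTemperleyLieb q N e) (hq : q ≠ 0) {k : ℕ} (hk : 1 ≤ k)
    (hkN : k < N) {a b : ℂ} (ha : a ≠ 0) (hb : b ≠ 0)
    (hab : q ^ 2 * a - b ≠ 0) (hba : q ^ 2 * b - a ≠ 0) :
    baxter q e (a / b) k * baxter q e (b / a) k = 1 := by
  have := fR_add_fR_inv hq ha hb hab hba
  simp only [baxter, sub_mul, mul_sub, one_mul, mul_one, smul_mul_assoc, mul_smul_comm, smul_sub,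
    h.sq k hk hkN]
  linear_combination (norm := module) (-this) • e k

theorem baxter_braid (h : IsTemperleyLieb q N e) (hq : q ≠ 0) {k : ℕ} (hk : 1 ≤ k)
    (hkN : k + 1 < N) {a b c : ℂ} (ha : a ≠ 0) (hb : b ≠ 0)
    (hab : q ^ 2 * a - b ≠ 0) (hca : q ^ 2 * c - a ≠ 0) (hcb : q ^ 2 * c - b ≠ 0) :
    baxter q e (a / b) k * baxter q e (c / b) (k + 1) * baxter q e (c / a) k =
      baxter q e (c / a) (k + 1) * baxter q e (c / b) k * baxter q e (a / b) (k + 1) :=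
  braid_of_scalar (h.sq k hk (by lia)) (h.sq (k + 1) (by lia) hkN) (h.up k hk hkN)
    (h.down k hk hkN) (fR_braid hq ha hb hab hca hcb)

theorem baxter_comm (h : IsTemperleyLieb q N e) {i j : ℕ} (hi : 1 ≤ i) (hij : i + 2 ≤ j)
    (hj : j < N) (u v : ℂ) : Commute (baxter q e u i) (baxter q e v j) :=
  Commute.baxter_left (Commute.baxter_right (h.comm i j hi hij hj) v) u

theorem baxter_intertwine (h : IsTemperleyLieb q N e) (hq : q ≠ 0) {k : ℕ} (hk : 1 ≤ k)
    (hkN : k + 1 < N) {a b c : ℂ} (ha : a ≠ 0) (hb : b ≠ 0) (hc : c ≠ 0)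
    (hab : q ^ 2 * a - b ≠ 0) (hac : q ^ 2 * a - c ≠ 0) (hca : q ^ 2 * c - a ≠ 0)
    (hbc : q ^ 2 * b - c ≠ 0) (hcb : q ^ 2 * c - b ≠ 0) :
    baxter q e (a / b) k * (pot q b c • e (k + 1) + pot q a c •
        (baxter q e (c / b) (k + 1) * e k * baxter q e (b / c) (k + 1))) =
      (pot q a c • e (k + 1) + pot q b c •
        (baxter q e (c / a) (k + 1) * e k * baxter q e (a / c) (k + 1))) *
          baxter q e (a / b) k := by
  refine intertwine_of_scalar (h.sq k hk (by lia)) (h.up k hk hkN) (h.down k hk hkN) ?_ ?_ ?_ ?_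
  all_goals
    simp only [fR_div hq ha, fR_div hq hb, fR_div hq hc, pot_eq hq]
    field_simp
    ring

/-- The terms of the Hamiltonian coupling a spin with parameter `c` at site `k + 1` to the
spins with parameters `y 1, …, y k` on its left. -/
def _root_.Stmt1.coupling (q : ℂ) (e : ℕ → A) (y : ℕ → ℂ) (c : ℂ) : ℕ → A
  | 0 => 0
  | k + 1 => pot q (y (k + 1)) c • e (k + 1) +
      baxter q e (c / y (k + 1)) (k + 1) * coupling q e y c k * baxter q e (y (k + 1) / c) (k + 1)

theorem _root_.Stmt1.coupling_congr (e : ℕ → A) {y y' : ℕ → ℂ} (c : ℂ) {k : ℕ}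
    (h : ∀ i, 1 ≤ i → i ≤ k → y i = y' i) : coupling q e y c k = coupling q e y' c k := by
  induction k with
  | zero => rfl
  | succ k ih =>
    rw [coupling, coupling, ih fun i hi hik => h i hi (by lia), h (k + 1) (by lia) le_rfl]

theorem coupling_comm (h : IsTemperleyLieb q N e) (y : ℕ → ℂ) (c : ℂ) {k j : ℕ}
    (hkj : k + 2 ≤ j) (hj : j < N) : Commute (coupling q e y c k) (e j) := by
  induction k with
  | zero => exact Commute.zero_left _
  | succ k ih =>
    have hc := h.comm (k + 1) j (by lia) (by lia) hj
    exact (hc.smul_left _).add_left (((Commute.baxter_left hc _).mul_left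
      (ih (by lia))).mul_left (Commute.baxter_left hc _))

/-- Exchanging the parameters at sites `k` and `k + 1`, both to the left of site `j + 1`. -/
theorem baxter_mul_coupling (h : IsTemperleyLieb q N e) (hq : q ≠ 0) {y : ℕ → ℂ} {c : ℂ}
    (hy : ∀ i, y i ≠ 0) (hc : c ≠ 0) (hyy : ∀ i j, q ^ 2 * y i - y j ≠ 0)
    (hyc : ∀ i, q ^ 2 * y i - c ≠ 0) (hcy : ∀ i, q ^ 2 * c - y i ≠ 0)
    {k j : ℕ} (hk : 1 ≤ k) (hkj : k + 1 ≤ j) (hj : j < N) :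
    baxter q e (y k / y (k + 1)) k * coupling q e y c j =
      coupling q e (y ∘ Equiv.swap k (k + 1)) c j * baxter q e (y k / y (k + 1)) k := by
  induction j, hkj using Nat.le_induction with
  | base =>
    obtain ⟨k, rfl⟩ : ∃ l, k = l + 1 := ⟨k - 1, by lia⟩
    have hX : coupling q e (y ∘ Equiv.swap (k + 1) (k + 1 + 1)) c k = coupling q e y c k := by
      refine coupling_congr e c fun i hi hik => ?_
      rw [Function.comp_apply, Equiv.swap_apply_of_ne_of_ne (by lia) (by lia)]
    have h₁ := h.baxter_intertwine hq hk hj (hy (k + 1)) (hy (k + 1 + 1)) hc (hyy _ _) (hyc _)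
      (hcy _) (hyc _) (hcy _)
    have h₂ := h.baxter_braid hq hk hj (hy (k + 1)) (hy (k + 1 + 1)) (hyy _ _) (hcy _) (hcy _)
    have h₃ := h.baxter_braid hq hk hj (a := y (k + 1 + 1)) (b := c) (c := y (k + 1)) (hy _) hc
      (hyc _) (hyy _ _) (hyc _)
    have hXc (u : ℂ) : Commute (coupling q e y c k) (baxter q e u (k + 1 + 1)) :=
      Commute.baxter_right (h.coupling_comm y c (by lia) hj) u
    simp only [coupling, hX, Function.comp_apply, Equiv.swap_apply_left, Equiv.swap_apply_right]
    generalize coupling q e y c k = X at *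
    have h₄ : baxter q e (y (k + 1) / y (k + 1 + 1)) (k + 1) *
        (baxter q e (c / y (k + 1 + 1)) (k + 1 + 1) *
          (baxter q e (c / y (k + 1)) (k + 1) * X * baxter q e (y (k + 1) / c) (k + 1)) *
          baxter q e (y (k + 1 + 1) / c) (k + 1 + 1)) =
        baxter q e (c / y (k + 1)) (k + 1 + 1) *
          (baxter q e (c / y (k + 1 + 1)) (k + 1) * X * baxter q e (y (k + 1 + 1) / c) (k + 1)) *
          baxter q e (y (k + 1) / c) (k + 1 + 1) *
          baxter q e (y (k + 1) / y (k + 1 + 1)) (k + 1) := by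
      simp only [mul_assoc] at h₂ h₃ ⊢
      rw [h₃]
      simp only [← mul_assoc] at h₂ h₃ ⊢
      rw [h₂]
      simp only [mul_assoc]
      rw [← mul_assoc _ X, ← (hXc _).eq]
      simp only [mul_assoc]
    simp only [mul_add, add_mul, mul_smul_comm, smul_mul_assoc] at h₁ h₄ ⊢
    rw [← add_assoc, ← add_assoc, h₁, h₄]
  | succ j hkj ih =>
    have hs : (y ∘ Equiv.swap k (k + 1)) (j + 1) = y (j + 1) := by
      rw [Function.comp_apply, Equiv.swap_apply_of_ne_of_ne (by lia) (by lia)]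
    have hb (u : ℂ) : Commute (baxter q e (y k / y (k + 1)) k) (baxter q e u (j + 1)) :=
      h.baxter_comm hk (by lia) hj _ _
    have he : Commute (baxter q e (y k / y (k + 1)) k) (e (j + 1)) :=
      Commute.baxter_left (h.comm k (j + 1) hk (by lia) hj) _
    rw [coupling, coupling, hs, mul_add, add_mul, mul_smul_comm, smul_mul_assoc, he.eq,
      ← mul_assoc, ← mul_assoc, (hb _).eq, mul_assoc _ _ (coupling _ _ _ _ _), ih (by lia),
      mul_assoc _ _ (baxter q e (y k / y (k + 1)) k), ← (hb _).eq]
    simp only [mul_assoc]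

/-- The (unnormalised) Hamiltonian of the inhomogeneous chain with parameters `y`. -/
def _root_.Stmt1.hamiltonian (q : ℂ) (N : ℕ) (e : ℕ → A) (y : ℕ → ℂ) : A :=
  ∑ k ∈ Finset.range N, coupling q e y (y (k + 1)) k

theorem baxter_mul_hamiltonian (h : IsTemperleyLieb q N e) (hq : q ≠ 0) {y : ℕ → ℂ}
    (hy : ∀ i, y i ≠ 0) (hyy : ∀ i j, q ^ 2 * y i - y j ≠ 0) {k : ℕ} (hk : 1 ≤ k) (hkN : k < N) :
    baxter q e (y k / y (k + 1)) k * hamiltonian q N e y =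
      hamiltonian q N e (y ∘ Equiv.swap k (k + 1)) * baxter q e (y k / y (k + 1)) k := by
  obtain ⟨k, rfl⟩ : ∃ l, k = l + 1 := ⟨k - 1, by lia⟩
  obtain ⟨m, rfl⟩ : ∃ m, N = k + 2 + m := ⟨N - (k + 2), by lia⟩
  have hswap (i : ℕ) (h₁ : i ≠ k + 1) (h₂ : i ≠ k + 1 + 1) :
      (y ∘ Equiv.swap (k + 1) (k + 1 + 1)) i = y i := by
    rw [Function.comp_apply, Equiv.swap_apply_of_ne_of_ne h₁ h₂]
  have hsplit (F : ℕ → A) : ∑ i ∈ Finset.range (k + 2 + m), F i =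
      ∑ i ∈ Finset.range k, F i + (F k + F (k + 1)) + ∑ i ∈ Finset.range m, F (k + 2 + i) := by
    rw [Finset.sum_range_add, Finset.sum_range_succ, Finset.sum_range_succ, add_assoc (∑ _ ∈ _, _)]
  rw [hamiltonian, hamiltonian, hsplit, hsplit]
  simp only [mul_add, add_mul, Finset.mul_sum, Finset.sum_mul]
  have hlow (c : ℂ) (i : ℕ) (hi : i ≤ k) :
      coupling q e (y ∘ Equiv.swap (k + 1) (k + 1 + 1)) c i = coupling q e y c i :=
    coupling_congr e c fun l _ _ => hswap l (by lia) (by lia)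
  congr 1
  · congr 1
    · refine Finset.sum_congr rfl fun i hi => ?_
      have hi := Finset.mem_range.1 hi
      rw [hswap (i + 1) (by lia) (by lia), hlow _ i hi.le]
      exact (Commute.baxter_right (h.coupling_comm _ _ (by lia) hkN) _).eq.symm
    · have h₁ := h.baxter_mul_baxter_inv hq hk hkN (hy (k + 1)) (hy (k + 1 + 1)) (hyy _ _) (hyy _ _)
      have hp : pot q (y (k + 1 + 1)) (y (k + 1)) = pot q (y (k + 1)) (y (k + 1 + 1)) := by
        rw [pot, pot, mul_comm (y (k + 1)), mul_comm (q * y (k + 1) - _)]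
      have he : Commute (baxter q e (y (k + 1) / y (k + 1 + 1)) (k + 1)) (e (k + 1)) :=
        Commute.baxter_left (Commute.refl _) _
      have h₂ := h.baxter_mul_baxter_inv hq hk hkN (hy (k + 1 + 1)) (hy (k + 1)) (hyy _ _) (hyy _ _)
      simp only [coupling, hlow _ k le_rfl, Function.comp_apply, Equiv.swap_apply_left,
        Equiv.swap_apply_right, hp, mul_add, add_mul, mul_smul_comm, smul_mul_assoc, he.eq]
      simp only [← mul_assoc, h₁, one_mul]
      simp only [mul_assoc, h₂, mul_one]
      abel
  · refine Finset.sum_congr rfl fun i hi => ?_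
    have hi := Finset.mem_range.1 hi
    rw [hswap _ (by lia) (by lia)]
    exact h.baxter_mul_coupling hq hy (hy _) hyy (fun _ => hyy _ _) (fun _ => hyy _ _) hk
      (by lia) (by lia)

end IsTemperleyLieb

end TemperleyLieb

section Monoid

variable {M : Type*} [Monoid M]

/-- The product `s n * ⋯ * s 1`. -/
def descProd (s : ℕ → M) : ℕ → M
  | 0 => 1
  | n + 1 => s (n + 1) * descProd s n

/-- The product `s 1 * ⋯ * s n`. -/
def ascProd (s : ℕ → M) : ℕ → M
  | 0 => 1
  | n + 1 => ascProd s n * s (n + 1)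

theorem descProd_congr {s t : ℕ → M} {n : ℕ} (h : ∀ k, 1 ≤ k → k ≤ n → s k = t k) :
    descProd s n = descProd t n := by
  induction n with
  | zero => rfl
  | succ n ih => rw [descProd, descProd, h _ (by lia) le_rfl, ih fun k h₁ h₂ => h k h₁ (by lia)]

theorem descProd_eq_prod (s : ℕ → M) (n : ℕ) :
    descProd s n = ((List.range' 1 n).reverse.map s).prod := by
  induction n with
  | zero => rfl
  | succ n ih => simp [descProd, ih, List.range'_1_concat, add_comm 1 n]

theorem descProd_succ' (s : ℕ → M) (n : ℕ) :
    descProd s (n + 1) = descProd (fun k => s (k + 1)) n * s 1 := by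
  induction n with
  | zero => simp [descProd]
  | succ n ih => rw [descProd, ih, descProd, mul_assoc]

theorem ascProd_succ' (s : ℕ → M) (n : ℕ) :
    ascProd s (n + 1) = s 1 * ascProd (fun k => s (k + 1)) n := by
  induction n with
  | zero => simp [ascProd]
  | succ n ih => rw [ascProd, ih, ascProd, mul_assoc]

theorem descProd_mul_ascProd {s : ℕ → M} {n : ℕ} (h : ∀ k, 1 ≤ k → k ≤ n → s k * s k = 1) :
    descProd s n * ascProd s n = 1 := by
  induction n generalizing s with
  | zero => simp [descProd, ascProd]
  | succ n ih =>
    rw [descProd_succ', ascProd_succ', mul_assoc, ← mul_assoc (s 1), h 1 le_rfl (by lia), one_mul,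
      ih fun k _ hk => h (k + 1) (by lia) (by lia)]

theorem Commute.descProd_left {s : ℕ → M} {x : M} {n : ℕ}
    (h : ∀ k, 1 ≤ k → k ≤ n → Commute (s k) x) : Commute (descProd s n) x := by
  induction n with
  | zero => exact Commute.one_left x
  | succ n ih => exact (h _ (by lia) le_rfl).mul_left (ih fun k h₁ h₂ => h k h₁ (by lia))

theorem mul_descProd {s : ℕ → M} {n : ℕ}
    (hbraid : ∀ k, 1 ≤ k → k + 1 ≤ n → s k * s (k + 1) * s k = s (k + 1) * s k * s (k + 1))
    (hcomm : ∀ i j, 1 ≤ i → i + 2 ≤ j → j ≤ n → Commute (s i) (s j))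
    {i : ℕ} (hi : 1 ≤ i) (hin : i + 1 ≤ n) : s i * descProd s n = descProd s n * s (i + 1) := by
  induction n, hin using Nat.le_induction with
  | base =>
    obtain ⟨i, rfl⟩ : ∃ l, i = l + 1 := ⟨i - 1, by lia⟩
    have hc : Commute (descProd s i) (s (i + 1 + 1)) :=
      Commute.descProd_left fun k h₁ h₂ => hcomm k _ h₁ (by lia) le_rfl
    rw [descProd, descProd, ← mul_assoc, ← mul_assoc, hbraid _ hi le_rfl, mul_assoc, ← hc.eq]
    simp only [mul_assoc]
  | succ n hn ih =>
    rw [descProd, ← mul_assoc, (hcomm i (n + 1) hi (by lia) le_rfl).eq, mul_assoc,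
      ih (fun k h₁ h₂ => hbraid k h₁ (by lia)) (fun i j h₁ h₂ h₃ => hcomm i j h₁ h₂ (by lia)),
      mul_assoc]

/-- A Coxeter element of the symmetric group on `n + 1` letters has order dividing `n + 1`. -/
theorem descProd_pow_eq_one {s : ℕ → M} {n : ℕ} (hsq : ∀ k, 1 ≤ k → k ≤ n → s k * s k = 1)
    (hbraid : ∀ k, 1 ≤ k → k + 1 ≤ n → s k * s (k + 1) * s k = s (k + 1) * s k * s (k + 1))
    (hcomm : ∀ i j, 1 ≤ i → i + 2 ≤ j → j ≤ n → Commute (s i) (s j)) :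
    descProd s n ^ (n + 1) = 1 := by
  induction n with
  | zero => simp [descProd]
  | succ n ih =>
    have ih := ih (fun k h₁ h₂ => hsq k h₁ (by lia)) (fun k h₁ h₂ => hbraid k h₁ (by lia))
      (fun i j h₁ h₂ h₃ => hcomm i j h₁ h₂ (by lia))
    have hs {i : ℕ} (hi : 1 ≤ i) (hin : i ≤ n) :
        s i * descProd s (n + 1) = descProd s (n + 1) * s (i + 1) :=
      mul_descProd hbraid hcomm hi (by lia)
    have hd (m : ℕ) (hm : m ≤ n) : descProd s m * descProd s (n + 1) =
        descProd s (n + 1) * descProd (fun k => s (k + 1)) m := by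
      induction m with
      | zero => simp [descProd]
      | succ m ihm =>
        rw [descProd, mul_assoc, ihm (by lia), ← mul_assoc, hs (by lia) hm, mul_assoc]
        rfl
    have ha (m : ℕ) (hm : m ≤ n) : ascProd s m * descProd s (n + 1) =
        descProd s (n + 1) * ascProd (fun k => s (k + 1)) m := by
      induction m with
      | zero => simp [ascProd]
      | succ m ihm =>
        rw [ascProd, mul_assoc, hs (by lia) hm, ← mul_assoc, ihm (by lia), mul_assoc, ascProd]
    have hpow (m : ℕ) (hm : m ≤ n + 1) : descProd s (n + 1) ^ (m + 1) =
        descProd s n ^ m * (descProd s (n + 1) * ascProd s m) := by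
      induction m with
      | zero => simp [ascProd]
      | succ m ihm =>
        have hsq : descProd s (n + 1) * descProd s (n + 1) =
            descProd s n * (descProd s (n + 1) * s 1) := by
          rw [← mul_assoc, hd n le_rfl, mul_assoc, ← descProd_succ']
        rw [pow_succ, ihm (by lia), pow_succ, mul_assoc, mul_assoc (descProd s (n + 1)),
          ha m (by lia), ← mul_assoc (descProd s (n + 1)), hsq, ascProd_succ']
        simp only [mul_assoc]
    rw [hpow (n + 1) le_rfl, ih, one_mul, descProd_mul_ascProd hsq]

end Monoid

/-- The cyclic permutation `i ↦ i + 1` for `1 ≤ i ≤ n`, `n + 1 ↦ 1`. -/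
def cyc : ℕ → Equiv.Perm ℕ
  | 0 => 1
  | n + 1 => cyc n * Equiv.swap (n + 1) (n + 1 + 1)

theorem cyc_of_lt {n i : ℕ} (h : n + 1 < i) : cyc n i = i := by
  induction n with
  | zero => rfl
  | succ n ih =>
    rw [cyc, Equiv.Perm.mul_apply, Equiv.swap_apply_of_ne_of_ne (by lia) (by lia), ih (by lia)]

theorem cyc_last (n : ℕ) : cyc n (n + 1) = 1 := by
  induction n with
  | zero => rfl
  | succ n ih => rw [cyc, Equiv.Perm.mul_apply, Equiv.swap_apply_right, ih]

theorem cyc_of_le {n i : ℕ} (hi : 1 ≤ i) (hin : i ≤ n) : cyc n i = i + 1 := by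
  induction n with
  | zero => lia
  | succ n ih =>
    rw [cyc, Equiv.Perm.mul_apply]
    rcases eq_or_ne i (n + 1) with rfl | h
    · rw [Equiv.swap_apply_left, cyc_of_lt (by lia)]
    · rw [Equiv.swap_apply_of_ne_of_ne h (by lia), ih (by lia)]

section Transport

variable {A : Type*} [Ring A] [Algebra ℂ A]

theorem coupling_const_mul (q : ℂ) (e : ℕ → A) {l : ℂ} (hl : l ≠ 0) (y : ℕ → ℂ) (c : ℂ) (k : ℕ) :
    coupling q e (fun i => l * y i) (l * c) k = coupling q e y c k := by
  have hp (a b : ℂ) : pot q (l * a) (l * b) = pot q a b := by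
    rw [pot, pot, show l * a * (l * b) = l ^ 2 * (a * b) by ring,
      show (q * (l * a) - q⁻¹ * (l * b)) * (q * (l * b) - q⁻¹ * (l * a)) =
        l ^ 2 * ((q * a - q⁻¹ * b) * (q * b - q⁻¹ * a)) by ring,
      mul_div_mul_left _ _ (pow_ne_zero 2 hl)]
  induction k with
  | zero => rfl
  | succ k ih => rw [coupling, coupling, ih, hp, mul_div_mul_left _ _ hl, mul_div_mul_left _ _ hl]

theorem hamiltonian_eq_of_eq_mul {q : ℂ} {N : ℕ} (e : ℕ → A) {l : ℂ} (hl : l ≠ 0) {y y' : ℕ → ℂ}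
    (h : ∀ i, 1 ≤ i → i ≤ N → y' i = l * y i) : hamiltonian q N e y' = hamiltonian q N e y := by
  refine Finset.sum_congr rfl fun k hk => ?_
  have hk := Finset.mem_range.1 hk
  rw [coupling_congr e _ fun i h₁ h₂ => h i h₁ (by lia), h (k + 1) (by lia) (by lia),
    coupling_const_mul q e hl]

namespace IsTemperleyLieb

variable {q : ℂ} {N : ℕ}

theorem descProd_mul_hamiltonian {e : ℕ → A} (h : IsTemperleyLieb q N e) (hq : q ≠ 0) {y : ℕ → ℂ}
    (hy : ∀ i, y i ≠ 0) (hyy : ∀ i j, q ^ 2 * y i - y j ≠ 0) {n : ℕ} (hn : n < N) :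
    descProd (fun k => baxter q e (y 1 / y (k + 1)) k) n * hamiltonian q N e y =
      hamiltonian q N e (y ∘ cyc n) * descProd (fun k => baxter q e (y 1 / y (k + 1)) k) n := by
  induction n with
  | zero => simp [descProd, cyc]
  | succ n ih =>
    have hb := h.baxter_mul_hamiltonian hq (y := y ∘ cyc n) (fun _ => hy _) (fun _ _ => hyy _ _)
      (k := n + 1) (by lia) hn
    simp only [Function.comp_apply, cyc_last, cyc_of_lt (Nat.lt_succ_self (n + 1))] at hb
    rw [descProd, mul_assoc, ih (by lia), ← mul_assoc, hb, mul_assoc]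
    rfl

variable {H : Type*} [AddCommGroup H] [Module ℂ H] {e : ℕ → Module.End ℂ H} {S : Set ℂ}

/-- The adjacent transpositions, acting on vector-valued functions of the parameters. -/
def _root_.Stmt1.paramSwap (q : ℂ) (e : ℕ → Module.End ℂ H) (S : Set ℂ) (k : ℕ) :
    Function.End ((ℕ → S) → H) := fun φ y =>
  baxter q e (y (k + 1) / y k) k (φ (y ∘ Equiv.swap k (k + 1)))

theorem _root_.Stmt1.descProd_paramSwap (n : ℕ) (φ : (ℕ → S) → H) (y : ℕ → S) :
    descProd (paramSwap q e S) n φ y =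
      descProd (fun k => baxter q e (y (n + 1) / y k) k) n (φ (y ∘ ⇑(cyc n)⁻¹)) := by
  induction n generalizing y with
  | zero => rfl
  | succ n ih =>
    rw [descProd, descProd]
    change baxter q e _ _ (descProd (paramSwap q e S) n φ _) = _
    rw [ih, cyc, mul_inv_rev, Equiv.swap_inv]
    have hd : descProd (fun k => baxter q e (((y ∘ Equiv.swap (n + 1) (n + 1 + 1)) (n + 1) : S) /
        ((y ∘ Equiv.swap (n + 1) (n + 1 + 1)) k : S) : ℂ) k) n =
        descProd (fun k => baxter q e (y (n + 1 + 1) / y k) k) n := by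
      refine descProd_congr fun k h₁ h₂ => ?_
      rw [Function.comp_apply, Function.comp_apply, Equiv.swap_apply_left,
        Equiv.swap_apply_of_ne_of_ne (by lia) (by lia)]
    rw [hd]
    rfl

theorem descProd_paramSwap_pow (h : IsTemperleyLieb q (N + 1) e) (hq : q ≠ 0)
    (hS : ∀ a ∈ S, a ≠ 0) (hSS : ∀ a ∈ S, ∀ b ∈ S, q ^ 2 * a - b ≠ 0) :
    descProd (paramSwap q e S) N ^ (N + 1) = 1 := by
  have hy (y : ℕ → S) (i) : (y i : ℂ) ≠ 0 := hS _ (y i).2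
  have hyy (y : ℕ → S) (i j) : q ^ 2 * (y i : ℂ) - y j ≠ 0 := hSS _ (y i).2 _ (y j).2
  refine descProd_pow_eq_one (fun k h₁ h₂ => ?_) (fun k h₁ h₂ => ?_) (fun i j h₁ h₂ h₃ => ?_)
  · funext φ y
    have hb := h.baxter_mul_baxter_inv hq h₁ (by lia) (hy y (k + 1)) (hy y k) (hyy y _ _)
      (hyy y _ _)
    change baxter q e _ k (baxter q e (((y ∘ Equiv.swap k (k + 1)) (k + 1) : S) /
      ((y ∘ Equiv.swap k (k + 1)) k : S) : ℂ) k (φ ((y ∘ _) ∘ _))) = φ y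
    rw [Function.comp_assoc, ← Equiv.Perm.coe_mul, Equiv.swap_mul_self, Function.comp_apply,
      Function.comp_apply, Equiv.swap_apply_left, Equiv.swap_apply_right, ← Module.End.mul_apply,
      hb]
    rfl
  · funext φ y
    have hb := h.baxter_braid hq h₁ (by lia) (hy y (k + 1)) (hy y k) (hyy y _ _)
      (hyy y (k + 1 + 1) _) (hyy y _ _)
    have hs : Equiv.swap k (k + 1) * Equiv.swap (k + 1) (k + 1 + 1) * Equiv.swap k (k + 1) =
        Equiv.swap (k + 1) (k + 1 + 1) * Equiv.swap k (k + 1) *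
          Equiv.swap (k + 1) (k + 1 + 1) := by
      rw [Equiv.swap_mul_swap_mul_swap (by lia) (by lia), Equiv.swap_comm k (k + 1),
        Equiv.swap_comm (k + 1) (k + 1 + 1),
        Equiv.swap_mul_swap_mul_swap (by lia) (by lia), Equiv.swap_comm]
    have e₁ : Equiv.swap k (k + 1) (k + 1 + 1) = k + 1 + 1 :=
      Equiv.swap_apply_of_ne_of_ne (by lia) (by lia)
    have e₂ : Equiv.swap (k + 1) (k + 1 + 1) k = k :=
      Equiv.swap_apply_of_ne_of_ne (by lia) (by lia)
    have hb' := LinearMap.congr_fun hb (φ (y ∘ ⇑(Equiv.swap k (k + 1) *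
      Equiv.swap (k + 1) (k + 1 + 1) * Equiv.swap k (k + 1))))
    conv_rhs at hb' => rw [hs]
    convert hb' using 1
    · change baxter q e _ k (baxter q e _ (k + 1) (baxter q e _ k (φ (((y ∘ _) ∘ _) ∘ _)))) =
        baxter q e _ k (baxter q e _ (k + 1) (baxter q e _ k _))
      simp only [Function.comp_apply, Equiv.swap_apply_left, Equiv.swap_apply_right, e₁, e₂]
      rfl
    · change baxter q e _ (k + 1) (baxter q e _ k (baxter q e _ (k + 1) (φ (((y ∘ _) ∘ _) ∘ _)))) =
        baxter q e _ (k + 1) (baxter q e _ k (baxter q e _ (k + 1) _))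
      simp only [Function.comp_apply, Equiv.swap_apply_left, Equiv.swap_apply_right, e₁, e₂]
      rfl
  · funext φ y
    have hs : Equiv.swap i (i + 1) * Equiv.swap j (j + 1) =
        Equiv.swap j (j + 1) * Equiv.swap i (i + 1) :=
      (Equiv.Perm.disjoint_swap_swap (by simp; lia)).commute.eq
    have hb (u v : ℂ) := LinearMap.congr_fun (h.baxter_comm h₁ h₂ (by lia) u v).eq
      (φ (y ∘ ⇑(Equiv.swap i (i + 1) * Equiv.swap j (j + 1))))
    change baxter q e _ i (baxter q e (((y ∘ Equiv.swap i (i + 1)) (j + 1) : S) /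
      ((y ∘ Equiv.swap i (i + 1)) j : S) : ℂ) j (φ ((y ∘ _) ∘ _))) =
      baxter q e _ j (baxter q e (((y ∘ Equiv.swap j (j + 1)) (i + 1) : S) /
      ((y ∘ Equiv.swap j (j + 1)) i : S) : ℂ) i (φ ((y ∘ _) ∘ _)))
    simp only [Function.comp_apply]
    rw [Equiv.swap_apply_of_ne_of_ne (by lia) (by lia),
      Equiv.swap_apply_of_ne_of_ne (by lia) (by lia),
      Equiv.swap_apply_of_ne_of_ne (by lia) (by lia),
      Equiv.swap_apply_of_ne_of_ne (by lia) (by lia), Function.comp_assoc, Function.comp_assoc,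
      ← Equiv.Perm.coe_mul, ← Equiv.Perm.coe_mul, ← hs]
    exact hb _ _

end IsTemperleyLieb

end Transport

theorem twoSiteOp_comm {N : ℕ} (A B : Bool → Bool → Bool → Bool → ℂ) {a b c d : ZMod N}
    (hac : a ≠ c) (had : a ≠ d) (hbc : b ≠ c) (hbd : b ≠ d) (ψ : Chain N) :
    twoSiteOp A a b (twoSiteOp B c d ψ) = twoSiteOp B c d (twoSiteOp A a b ψ) := by
  funext x
  simp only [twoSiteOp, Finset.mul_sum]
  rw [Finset.sum_comm]
  refine Finset.sum_congr rfl fun t _ => Finset.sum_congr rfl fun s _ => ?_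
  rw [Function.update_of_ne hbd.symm, Function.update_of_ne had.symm,
    Function.update_of_ne hbc.symm, Function.update_of_ne hac.symm,
    Function.update_of_ne hbd, Function.update_of_ne hbc,
    Function.update_of_ne had, Function.update_of_ne hac,
    Function.update_comm hbc, Function.update_comm hac,
    Function.update_comm hbd, Function.update_comm had]
  ring

theorem twoSiteOp_eE_sq {N : ℕ} {q : ℂ} (hq : q ≠ 0) {a b : ZMod N} (hab : a ≠ b)
    (ψ : Chain N) :
    twoSiteOp (eE q) a b (twoSiteOp (eE q) a b ψ) = (q + q⁻¹) • twoSiteOp (eE q) a b ψ := by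
  funext x
  have h (s t s' t' : Bool) : Function.update (Function.update (Function.update
      (Function.update x a s) b t) a s') b t' = Function.update (Function.update x a s') b t' := by
    rw [Function.update_comm hab.symm, Function.update_idem, Function.update_idem]
  cases hxa : x a <;> cases hxb : x b <;>
    simp [twoSiteOp, Fintype.sum_prod_type, hxa, hxb, eE, h, Function.update_of_ne hab] <;>
    field_simp <;> ring

theorem twoSiteOp_eE_apply {N : ℕ} {q : ℂ} {a b : ZMod N} (φ : Chain N) {x : ZMod N → Bool}
    {r s : Bool} (y : Bool → Bool → ZMod N → Bool) (hxa : x a = r) (hxb : x b = s)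
    (hy : ∀ r' s', Function.update (Function.update x a r') b s' = y r' s') :
    twoSiteOp (eE q) a b φ x =
      if r = s then 0 else (if r then q else q⁻¹) * φ (y r s) - φ (y s r) := by
  cases r <;> cases s <;>
    simp [twoSiteOp, Fintype.sum_prod_type, hxa, hxb, hy, eE] <;> ring

theorem twoSiteOp_eE_triple {N : ℕ} {q : ℂ} (hq : q ≠ 0) {a b c : ZMod N} (hab : a ≠ b)
    (hac : a ≠ c) (hbc : b ≠ c) (ψ : Chain N) :
    twoSiteOp (eE q) a b (twoSiteOp (eE q) b c (twoSiteOp (eE q) a b ψ)) =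
        twoSiteOp (eE q) a b ψ ∧
      twoSiteOp (eE q) b c (twoSiteOp (eE q) a b (twoSiteOp (eE q) b c ψ)) =
        twoSiteOp (eE q) b c ψ := by
  have hw (x : ZMod N → Bool) : ∃ w : Bool → Bool → Bool → ZMod N → Bool,
      x = w (x a) (x b) (x c) ∧
      (∀ (φ : Chain N) (r s t : Bool), twoSiteOp (eE q) a b φ (w r s t) =
        if r = s then 0 else (if r then q else q⁻¹) * φ (w r s t) - φ (w s r t)) ∧
      (∀ (φ : Chain N) (r s t : Bool), twoSiteOp (eE q) b c φ (w r s t) =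
        if s = t then 0 else (if s then q else q⁻¹) * φ (w r s t) - φ (w r t s)) := by
    refine ⟨fun r s t => Function.update (Function.update (Function.update x a r) b s) c t,
      by simp, fun φ r s t => ?_, fun φ r s t => ?_⟩
    · refine twoSiteOp_eE_apply φ
        (fun r s => Function.update (Function.update (Function.update x a r) b s) c t) ?_ ?_ ?_
      · simp [Function.update_of_ne hab, Function.update_of_ne hac]
      · simp [Function.update_of_ne hbc]
      · intro r' s'
        rw [Function.update_comm hac.symm, Function.update_comm hbc.symm,
          Function.update_comm hab.symm, Function.update_idem, Function.update_idem]
    · refine twoSiteOp_eE_apply φ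
        (fun s t => Function.update (Function.update (Function.update x a r) b s) c t) ?_ ?_ ?_
      · simp [Function.update_of_ne hbc]
      · simp
      · intro s' t'
        rw [Function.update_comm hbc.symm, Function.update_idem, Function.update_idem]
  constructor <;> funext x <;> obtain ⟨w, hx, h₁, h₂⟩ := hw x <;> rw [hx] <;>
    generalize x a = r <;> generalize x b = s <;> generalize x c = t <;> clear hx <;>
    revert r s t <;>
    simp [Bool.forall_bool, h₁, h₂] <;> field_simp <;> simp

section Chain

variable {N : ℕ} {q : ℂ}

/-- `twoSiteOp` as a linear map. -/
def twoSiteLin (A : Bool → Bool → Bool → Bool → ℂ) (a b : ZMod N) :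
    Module.End ℂ (Chain N) where
  toFun := twoSiteOp A a b
  map_add' φ ψ := by
    funext x
    simp [twoSiteOp, mul_add, Finset.sum_add_distrib]
  map_smul' c φ := by
    funext x
    simp only [twoSiteOp, Pi.smul_apply, smul_eq_mul, RingHom.id_apply, Finset.mul_sum]
    exact Finset.sum_congr rfl fun _ _ => by ring

/-- `eop` as a linear map. -/
def eLin (N : ℕ) (q : ℂ) (k : ℕ) : Module.End ℂ (Chain N) :=
  twoSiteLin (eE q) ((k : ℕ) : ZMod N) ((k + 1 : ℕ) : ZMod N)

theorem natCast_ne {a b : ℕ} (ha : 1 ≤ a) (hab : a < b) (hb : b ≤ N) :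
    (a : ZMod N) ≠ (b : ZMod N) := by
  intro h
  have := Nat.le_of_dvd (by lia)
    ((Nat.modEq_iff_dvd' hab.le).1 ((ZMod.natCast_eq_natCast_iff a b N).1 h))
  lia

theorem isTemperleyLieb_eLin (hq : q ≠ 0) : IsTemperleyLieb q N (eLin N q) where
  sq k h₁ h₂ := LinearMap.ext fun ψ =>
    twoSiteOp_eE_sq hq (natCast_ne h₁ (Nat.lt_succ_self k) h₂) ψ
  up k h₁ h₂ := LinearMap.ext fun ψ =>
    (twoSiteOp_eE_triple hq (natCast_ne h₁ (Nat.lt_succ_self k) h₂.le)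
      (natCast_ne h₁ (by lia) h₂) (natCast_ne (by lia) (Nat.lt_succ_self (k + 1)) h₂) ψ).1
  down k h₁ h₂ := LinearMap.ext fun ψ =>
    (twoSiteOp_eE_triple hq (natCast_ne h₁ (Nat.lt_succ_self k) h₂.le)
      (natCast_ne h₁ (by lia) h₂) (natCast_ne (by lia) (Nat.lt_succ_self (k + 1)) h₂) ψ).2
  comm i j h₁ h₂ h₃ := LinearMap.ext fun ψ =>
    twoSiteOp_comm (eE q) (eE q) (natCast_ne h₁ (by lia) (by lia))
      (natCast_ne h₁ (by lia) (by lia)) (natCast_ne (by lia) (by lia) (by lia))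
      (natCast_ne (by lia) (by lia) (by lia)) ψ

theorem Rop_eq_baxter {u : ℂ} (hu : q * u - q⁻¹ ≠ 0) {k : ℕ} :
    Rop N q u k = ⇑(baxter q (eLin N q) u k) := by
  have h₁ : u * gR q u = 1 - fR q u * q⁻¹ := by
    rw [gR, fR, div_mul_eq_mul_div, ← mul_div_assoc, eq_sub_iff_add_eq, ← add_div,
      div_eq_one_iff_eq hu]
    ring
  have h₂ : gR q u = 1 - fR q u * q := by
    rw [gR, fR, div_mul_eq_mul_div, eq_sub_iff_add_eq, ← add_div, div_eq_one_iff_eq hu]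
    ring
  funext ψ x
  change twoSiteOp (RE q u) _ _ ψ x = ψ x - fR q u * twoSiteOp (eE q) _ _ ψ x
  have hx : ψ x = ψ (Function.update (Function.update x (k : ZMod N) (x (k : ZMod N)))
      ((k + 1 : ℕ) : ZMod N) (x ((k + 1 : ℕ) : ZMod N))) := by simp
  rw [hx]
  simp only [twoSiteOp, Fintype.sum_prod_type, Fintype.sum_bool]
  cases x (k : ZMod N) <;> cases x ((k + 1 : ℕ) : ZMod N) <;> simp only [RE, eE]
  · ring
  · rw [h₁]
    ring
  · rw [h₂]
    ring
  · ring

theorem compList_map_eq {R V : Type*} [Semiring R] [AddCommMonoid V] [Module R V] {l : List ℕ}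
    {F : ℕ → V → V} {E : ℕ → Module.End R V} (h : ∀ k ∈ l, F k = ⇑(E k)) :
    compList (l.map F) = ⇑(l.map E).prod := by
  induction l with
  | nil => rfl
  | cons k l ih =>
    have ih := ih fun k hk => h k (List.mem_cons_of_mem _ hk)
    rw [List.map_cons, List.map_cons, List.prod_cons, Module.End.coe_mul, ← ih,
      ← h k List.mem_cons_self]
    rfl

theorem omega_pow_self (hN : 0 < N) : omega N ^ N = 1 :=
  (Complex.isPrimitiveRoot_exp N hN.ne').pow_eq_one

theorem omega_ne_zero : omega N ≠ 0 := Complex.exp_ne_zero _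

theorem regular_of_pow_eq_one (hq : q ^ (2 * N) ≠ 1) {a b : ℂ} (ha : a ^ N = 1)
    (hb : b ^ N = 1) : q ^ 2 * a - b ≠ 0 := by
  intro h
  apply hq
  rw [← sub_eq_zero.1 h, mul_pow, ha, mul_one] at hb
  rw [pow_mul, hb]

theorem denominator_ne_zero (hq0 : q ≠ 0) {a b : ℂ} (hb : b ≠ 0) (hab : q ^ 2 * a - b ≠ 0) :
    q * (a / b) - q⁻¹ ≠ 0 := by
  have : q * (a / b) - q⁻¹ = (q ^ 2 * a - b) / (q * b) := by field_simp
  rw [this]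
  exact div_ne_zero hab (mul_ne_zero hq0 hb)

theorem z_pow_self (hN : 0 < N) (j : ℕ) : z N j ^ N = 1 := by
  rw [z, ← pow_mul, mul_comm, pow_mul, omega_pow_self hN, one_pow]

theorem z_ne_zero (j : ℕ) : z N j ≠ 0 := pow_ne_zero _ omega_ne_zero

theorem Rop_z_div_z (hN : 0 < N) (hq0 : q ≠ 0) (hq : q ^ (2 * N) ≠ 1) (i j k : ℕ) :
    Rop N q (z N i / z N j) k = ⇑(baxter q (eLin N q) (z N i / z N j) k) :=
  Rop_eq_baxter (denominator_ne_zero hq0 (z_ne_zero j)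
    (regular_of_pow_eq_one hq (z_pow_self hN i) (z_pow_self hN j)))

/-- `SL` as a linear map. -/
def SLin (N : ℕ) (q : ℂ) (i m : ℕ) (c : ℂ) : Module.End ℂ (Chain N) :=
  ((List.range' (i + 1) (m - i)).reverse.map fun k => baxter q (eLin N q) (c / z N k) k).prod *
    eLin N q i *
      ((List.range' (i + 1) (m - i)).map fun k => baxter q (eLin N q) (z N k / c) k).prod

theorem SL_eq_SLin (hN : 0 < N) (hq0 : q ≠ 0) (hq : q ^ (2 * N) ≠ 1) (i m : ℕ) :
    SL N q i (m + 1) = ⇑(SLin N q i m (z N (m + 1))) := by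
  rw [SL, compList_map_eq fun k _ => Rop_z_div_z hN hq0 hq _ _ k,
    compList_map_eq fun k _ => Rop_z_div_z hN hq0 hq _ _ k]
  rfl

theorem coupling_eq_sum (c : ℂ) (m : ℕ) : coupling q (eLin N q) (z N) c m =
    ∑ i ∈ Finset.Ico 1 (m + 1), pot q (z N i) c • SLin N q i m c := by
  induction m with
  | zero => simp [coupling]
  | succ m ih =>
    rw [coupling, ih, Finset.sum_Ico_succ_top (show 1 ≤ m + 1 by lia), add_comm, Finset.mul_sum, Finset.sum_mul]
    congr 1
    · refine Finset.sum_congr rfl fun i hi => ?_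
      have hi := Finset.mem_Ico.1 hi
      have hr : List.range' (i + 1) (m + 1 - i) = List.range' (i + 1) (m - i) ++ [m + 1] := by
        rw [show m + 1 - i = m - i + 1 by lia, List.range'_1_concat,
          show i + 1 + (m - i) = m + 1 by lia]
      rw [SLin, SLin, hr, List.reverse_append, List.map_append, List.map_append, List.prod_append,
        List.prod_append, mul_smul_comm, smul_mul_assoc]
      simp [mul_assoc]
    · simp [SLin]

theorem HL_eq_hamiltonian (hN : 0 < N) (hq0 : q ≠ 0) (hq : q ^ (2 * N) ≠ 1) :
    HL N q = ⇑((qint q N / (N : ℂ)) • hamiltonian q N (eLin N q) (z N)) := by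
  funext ψ
  simp only [HL, hamiltonian, coupling_eq_sum, Pi.smul_apply, LinearMap.smul_apply,
    Finset.sum_apply, LinearMap.sum_apply, ← SL_eq_SLin hN hq0 hq]
  rw [Finset.range_eq_Ico, Finset.sum_Ico_add'
    (fun j => ∑ i ∈ Finset.Ico 1 j, pot q (z N i) (z N j) • SL N q i j ψ) 0 N 1]
  rfl

theorem G_eq_descProd (hN : 0 < N) (hq0 : q ≠ 0) (hq : q ^ (2 * N) ≠ 1) :
    G N q = ⇑(descProd (fun k => baxter q (eLin N q) ((omega N)⁻¹ ^ k) k) (N - 1)) := by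
  rw [descProd_eq_prod, G]
  refine compList_map_eq fun k _ => ?_
  have h := Rop_z_div_z hN hq0 hq 0 k k
  rwa [z, z, pow_zero, one_div, ← inv_pow] at h

theorem descProd_pow_card (hN : 0 < N) (hq0 : q ≠ 0) (hq : q ^ (2 * N) ≠ 1) :
    descProd (fun k => baxter q (eLin N q) ((omega N)⁻¹ ^ k) k) (N - 1) ^ N = 1 := by
  obtain ⟨n, rfl⟩ : ∃ n, N = n + 1 := ⟨N - 1, by lia⟩
  rw [Nat.add_sub_cancel]
  set g := descProd (fun k => baxter q (eLin (n + 1) q) ((omega (n + 1))⁻¹ ^ k) k) n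
  let S : Set ℂ := {a | a ^ (n + 1) = 1}
  have hS : ∀ a ∈ S, a ≠ 0 := by
    rintro a ha rfl
    simp [S] at ha
  have hone := (isTemperleyLieb_eLin (N := n + 1) hq0).descProd_paramSwap_pow hq0 hS
    fun a ha b hb => regular_of_pow_eq_one hq ha hb
  refine LinearMap.ext fun ψ => ?_
  have key (m : ℕ) (y : ℕ → S)
      (hy : ∀ k, 1 ≤ k → k ≤ n + 1 → (y k : ℂ) = y (n + 1) * omega (n + 1) ^ k) :
      (descProd (paramSwap q (eLin (n + 1) q) S) n ^ m : Function.End _) (fun _ => ψ) y =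
        (g ^ m) ψ := by
    induction m generalizing y with
    | zero => rfl
    | succ m ih =>
      rw [pow_succ', pow_succ']
      change descProd (paramSwap q (eLin (n + 1) q) S) n ((descProd (paramSwap q (eLin (n + 1) q) S) n ^ m :
        Function.End _) (fun _ => ψ)) y = g ((g ^ m) ψ)
      rw [descProd_paramSwap, ih]
      · congr 1
        refine descProd_congr fun k h₁ h₂ => ?_
        congr 1
        rw [hy k h₁ (by lia), div_mul_cancel_left₀ (hS _ (y (n + 1)).2), inv_pow]
      · have hc (i : ℕ) (h₁ : 1 ≤ i) (h₂ : i ≤ n) : (cyc n)⁻¹ (i + 1) = i := by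
          rw [Equiv.Perm.inv_eq_iff_eq, cyc_of_le h₁ h₂]
        have hc₁ : (cyc n)⁻¹ 1 = n + 1 := by rw [Equiv.Perm.inv_eq_iff_eq, cyc_last]
        intro k h₁ h₂
        simp only [Function.comp_apply]
        rcases n with - | n
        · obtain rfl : k = 1 := by lia
          have := omega_pow_self hN
          rw [zero_add] at this
          simp [this]
        · have ho := omega_pow_self hN
          rw [hc (n + 1) (by lia) le_rfl, hy (n + 1) (by lia) (by lia)]
          rcases k with - | k
          · lia
          rcases k with - | k
          · rw [zero_add, hc₁, mul_assoc, pow_one, ← pow_succ, ho, mul_one]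
          · rw [hc (k + 1) (by lia) (by lia), hy (k + 1) (by lia) (by lia), mul_assoc,
              ← pow_add, show n + 1 + (k + 1 + 1) = (n + 1 + 1) + (k + 1) by lia, pow_add _ (n + 1 + 1) (k + 1), ho,
              one_mul]
  have h := key (n + 1) (fun k => ⟨z (n + 1) k, z_pow_self hN k⟩) fun k _ _ => by
    simp only [z, omega_pow_self hN, one_mul]
  rw [← h, hone]
  rfl

theorem descProd_comm_hamiltonian (hN : 0 < N) (hq0 : q ≠ 0) (hq : q ^ (2 * N) ≠ 1) :
    Commute (descProd (fun k => baxter q (eLin N q) ((omega N)⁻¹ ^ k) k) (N - 1))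
      (hamiltonian q N (eLin N q) (z N)) := by
  have h := (isTemperleyLieb_eLin (N := N) hq0).descProd_mul_hamiltonian hq0 (y := z N) z_ne_zero
    (fun i j => regular_of_pow_eq_one hq (z_pow_self hN i) (z_pow_self hN j))
    (n := N - 1) (by lia)
  have hd : descProd (fun k => baxter q (eLin N q) (z N 1 / z N (k + 1)) k) (N - 1) =
      descProd (fun k => baxter q (eLin N q) ((omega N)⁻¹ ^ k) k) (N - 1) := by
    refine descProd_congr fun k _ _ => ?_
    congr 1
    rw [z, z, pow_one, pow_succ', inv_pow, div_mul_cancel_left₀ omega_ne_zero]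
  have hz : hamiltonian q N (eLin N q) (z N ∘ cyc (N - 1)) = hamiltonian q N (eLin N q) (z N) := by
    refine hamiltonian_eq_of_eq_mul _ (omega_ne_zero (N := N)) fun i h₁ h₂ => ?_
    rcases h₂.lt_or_eq with h₂ | rfl
    · rw [Function.comp_apply, cyc_of_le h₁ (by lia), z, z, pow_succ']
    · obtain ⟨n, rfl⟩ : ∃ n, i = n + 1 := ⟨i - 1, by lia⟩
      rw [Function.comp_apply, Nat.add_sub_cancel, cyc_last, z, z, omega_pow_self hN, pow_one,
        mul_one]
  rwa [hd, hz] at h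

end Chain

/-- `G^N = id` and `G` commutes with the Hamiltonian `H^L`. -/
theorem G_pow_N_eq_id_and_G_comm_HL (N : ℕ) (hN : 0 < N) (q : ℂ) (hq0 : q ≠ 0)
    (hq : q ^ (2 * N) ≠ 1) :
    (G N q)^[N] = id ∧ G N q ∘ HL N q = HL N q ∘ G N q := by
  rw [G_eq_descProd hN hq0 hq, HL_eq_hamiltonian hN hq0 hq]
  constructor
  · rw [← Module.End.coe_pow, descProd_pow_card hN hq0 hq]
    rfl
  · rw [← Module.End.coe_mul, ← Module.End.coe_mul,
      ((descProd_comm_hamiltonian hN hq0 hq).smul_right _).eq]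

end Stmt1
end
end
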